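/- arXiv:1401.6203 — 8 statements merged into one kernel-verified Lean document; each statement's English description precedes it below -/
import Mathlib

section
/- Every free group is subgroup conjugacy separable (SCS). That is, for every type X, if H₁ and H₂ are finitely generated subgroups of the free group F(X) that are not conjugate in F(X), then there exists a surjective group homomorphism φ from F(X) onto a finite group such that the images φ(H₁) and φ(H₂) are not conjugate in that finite group. -/
/-- `A.conjBy c` is the conjugate subgroup `A^c = c⁻¹ * A * c`. -/
def Subgroup.conjBy {G : Type*} [Group G] (A : Subgroup G) (c : G) : Subgroup G :=
  A.map (MulAut.conj c⁻¹).toMonoidHom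

/-- A group `G` is subgroup conjugacy separable (SCS) if any two finitely generated
subgroups of `G` that are not conjugate in `G` have non-conjugate images in some
finite quotient of `G`. -/
def SCS (G : Type*) [Group G] : Prop :=
  ∀ H₁ H₂ : Subgroup G, H₁.FG → H₂.FG → (¬ ∃ c : G, H₁.conjBy c = H₂) →
    ∃ (Q : Type) (_ : Group Q) (_ : Finite Q) (φ : G →* Q),
      Function.Surjective φ ∧ ¬ ∃ q : Q, (H₁.map φ).conjBy q = H₂.map φ

namespace FreeGroup

/-- A partial injection of a finite type extends to a permutation. -/
theorem exists_perm_extending {V : Type*} [Finite V] (r : V → V → Prop)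
    (hfun : ∀ u v v', r u v → r u v' → v = v') (hinj : ∀ u u' v, r u v → r u' v → u = u') :
    ∃ σ : Equiv.Perm V, ∀ u v, r u v → σ u = v := by
  classical
  have := Fintype.ofFinite V
  let f : V → V := fun u => if h : ∃ v, r u v then h.choose else u
  have hf : ∀ u v, r u v → f u = v := fun u v h => by
    have h' : ∃ v, r u v := ⟨v, h⟩
    simp only [f, dif_pos h']
    exact hfun u _ _ h'.choose_spec h
  obtain ⟨g, hg⟩ := Finset.exists_equiv_extend_of_card_eq (t := (Finset.univ : Finset V))
    (s := {u : V | ∃ v, r u v}) (f := f) (by simp) (by simp) (by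
      intro u hu u' hu' h
      simp only [Finset.coe_filter, Finset.mem_univ, true_and, Set.mem_ofPred_eq] at hu hu'
      obtain ⟨v, hv⟩ := hu
      obtain ⟨v', hv'⟩ := hu'
      rw [hf _ _ hv, hf _ _ hv'] at h
      subst h
      exact hinj _ _ _ hv hv')
  refine ⟨g.trans (Equiv.subtypeUnivEquiv (by simp)), fun u v h => ?_⟩
  have := hg u (by simpa using ⟨v, h⟩)
  rw [hf _ _ h] at this
  simpa using this

/-- Partial injections of a finite type indexed by `X` extend to an action of the free group. -/
theorem exists_hom_perm_extending {X V : Type*} [Finite V] (r : X → V → V → Prop)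
    (hfun : ∀ x u v v', r x u v → r x u v' → v = v')
    (hinj : ∀ x u u' v, r x u v → r x u' v → u = u') :
    ∃ ρ : FreeGroup X →* Equiv.Perm V, ∀ x u v, r x u v → ρ (of x) u = v := by
  choose σ hσ using fun x => exists_perm_extending (r x) (hfun x) (hinj x)
  exact ⟨lift σ, fun x u v h => by simpa using hσ x u v h⟩

theorem mk_cons {X : Type*} (s : X × Bool) (L : List (X × Bool)) : mk (s :: L) = mk [s] * mk L := by
  simp

theorem mk_singleton_true {X : Type*} (x : X) : mk [(x, true)] = of x := rfl

theorem mk_singleton_false {X : Type*} (x : X) : mk [(x, false)] = (of x)⁻¹ := rfl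

/-- `ρ` is an action on `Y` modelled on the action on `Z` through `ι : Y → Z`; the path that
spells the word `L` (read from right to left) from `y` agrees with the path in `Z`. -/
def Follows {X Y Z : Type*} [MulAction (FreeGroup X) Z] (ι : Y → Z)
    (ρ : FreeGroup X →* Equiv.Perm Y) (L : List (X × Bool)) (y : Y) : Prop :=
  ∀ L', L' <:+ L → ι (ρ (mk L') y) = mk L' • ι y

section Follows

variable {X Y Z : Type*} [MulAction (FreeGroup X) Z] {ι : Y → Z} {ρ : FreeGroup X →* Equiv.Perm Y}

theorem Follows.smul_eq {L : List (X × Bool)} {y : Y} (h : Follows ι ρ L y) :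
    ι (ρ (mk L) y) = mk L • ι y :=
  h L List.suffix_rfl

theorem Follows.of_suffix {L L' : List (X × Bool)} {y : Y} (h : Follows ι ρ L y)
    (hL : L' <:+ L) : Follows ι ρ L' y :=
  fun _ h' => h _ (h'.trans hL)

theorem follows_nil (y : Y) : Follows ι ρ [] y := by
  intro L h
  rw [List.suffix_nil.1 h]
  simp [← one_eq_mk]

theorem follows_cons {s : X × Bool} {L : List (X × Bool)} {y : Y} :
    Follows ι ρ (s :: L) y ↔ Follows ι ρ L y ∧
      ι (ρ (mk [s]) (ρ (mk L) y)) = mk [s] • ι (ρ (mk L) y) := by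
  constructor
  · intro h
    have hL := h.of_suffix (List.suffix_cons s L)
    refine ⟨hL, ?_⟩
    have := h.smul_eq
    rwa [mk_cons, _root_.map_mul, mul_smul, ← hL.smul_eq, Equiv.Perm.mul_apply] at this
  · rintro ⟨h, hs⟩ L' hL'
    rcases List.suffix_cons_iff.1 hL' with rfl | h'
    · rw [mk_cons, _root_.map_mul, mul_smul, ← h.smul_eq, Equiv.Perm.mul_apply, hs]
    · exact h _ h'

theorem exists_not_follows {L : List (X × Bool)} {y : Y} (h : ¬ Follows ι ρ L y) :
    ∃ i, ∃ hi : i < L.length,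
      ι (ρ (mk [L[i]]) (ρ (mk (L.drop (i + 1))) y)) ≠ mk [L[i]] • ι (ρ (mk (L.drop (i + 1))) y) := by
  induction L with
  | nil => exact (h (follows_nil y)).elim
  | cons s L ih =>
    by_cases hL : Follows ι ρ L y
    · exact ⟨0, by simp, fun h' => h (follows_cons.2 ⟨hL, by simpa using h'⟩)⟩
    · obtain ⟨i, hi, h'⟩ := ih hL
      exact ⟨i + 1, by simpa using hi, by simpa using h'⟩

/-- A letter is followed as soon as both ends of the edge lie in `Y`. -/
theorem perm_apply_eq_of_smul_eq (hρ : ∀ x u v, of x • ι u = ι v → ρ (of x) u = v)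
    (s : X × Bool) (u v : Y) (h : mk [s] • ι u = ι v) : ρ (mk [s]) u = v := by
  obtain ⟨x, _ | _⟩ := s
  · rw [mk_singleton_false] at h ⊢
    rw [_root_.map_inv, Equiv.Perm.inv_eq_iff_eq]
    exact (hρ x v u (by rw [← h, smul_inv_smul])).symm
  · exact hρ x u v h

end Follows

/-- Finite pieces of the Schreier graph of `H` extend to finite actions. -/
theorem exists_finite_action {X : Type*} [DecidableEq X] (H : Subgroup (FreeGroup X))
    (T : Set (FreeGroup X)) (hT : T.Finite) :
    ∃ (n : ℕ) (ι : Fin n → FreeGroup X ⧸ H) (ρ : FreeGroup X →* Equiv.Perm (Fin n)) (v₀ : Fin n),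
      Function.Injective ι ∧ ι v₀ = ((1 : FreeGroup X) : FreeGroup X ⧸ H) ∧
      ∀ w ∈ T, Follows ι ρ w.toWord v₀ := by
  let b : FreeGroup X ⧸ H := ((1 : FreeGroup X) : FreeGroup X ⧸ H)
  let V : Set (FreeGroup X ⧸ H) :=
    insert b (⋃ w ∈ T, (fun L => mk L • b) '' {L | L <:+ w.toWord})
  have hV : V.Finite := by
    refine (hT.biUnion fun w _ => Set.Finite.image _ ?_).insert _
    refine (List.finite_toSet w.toWord.tails).subset fun L hL => ?_
    simpa using hL
  have := hV.to_subtype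
  obtain ⟨n, ⟨e⟩⟩ := Finite.exists_equiv_fin V
  let ι : Fin n → FreeGroup X ⧸ H := fun i => (e.symm i : FreeGroup X ⧸ H)
  have hι : Function.Injective ι := Subtype.val_injective.comp e.symm.injective
  have hsurj : ∀ z ∈ V, ∃ i, ι i = z := fun z hz => ⟨e ⟨z, hz⟩, by simp [ι]⟩
  obtain ⟨ρ, hρ⟩ := exists_hom_perm_extending (fun (x : X) u v => of x • ι u = ι v)
    (fun x u v v' h h' => hι (h.symm.trans h'))
    (fun x u u' v h h' => hι (smul_left_cancel _ (h.trans h'.symm)))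
  obtain ⟨v₀, hv₀⟩ := hsurj b (Set.mem_insert _ _)
  refine ⟨n, ι, ρ, v₀, hι, hv₀, fun w hw => ?_⟩
  suffices ∀ L, L <:+ w.toWord → Follows ι ρ L v₀ from this _ List.suffix_rfl
  intro L
  induction L with
  | nil => exact fun _ => follows_nil v₀
  | cons s L ih =>
    intro hL
    have hL' := ih ((List.suffix_cons s L).trans hL)
    refine follows_cons.2 ⟨hL', ?_⟩
    obtain ⟨i, hi⟩ := hsurj (mk (s :: L) • b) (Set.mem_insert_of_mem _
      (Set.mem_biUnion hw ⟨_, hL, rfl⟩))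
    have h : mk [s] • ι (ρ (mk L) v₀) = ι i := by
      rw [hL'.smul_eq, hv₀, ← mul_smul, ← mk_cons, hi]
    rw [perm_apply_eq_of_smul_eq hρ s _ i h, h]

theorem not_inverse_of_isReduced_append_self {X : Type*} {L : List (X × Bool)}
    (hL : IsReduced (L ++ L)) {i j : ℕ} (hi : i < L.length) (hj : j < L.length)
    (hij : (j : ZMod L.length) = i + 1) (h : L[i].1 = L[j].1) : L[i].2 = L[j].2 := by
  have key := List.isChain_iff_getElem.1 hL i (by simp; omega)
  have hmod : j = (i + 1) % L.length := by
    have := (ZMod.natCast_eq_natCast_iff' j (i + 1) L.length).1 (by simpa using hij)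
    rwa [Nat.mod_eq_of_lt hj] at this
  have h2 : (L ++ L)[i + 1]'(by simp; omega) = L[j] := by
    rcases Nat.lt_or_ge (i + 1) L.length with h' | h'
    · rw [Nat.mod_eq_of_lt h'] at hmod
      subst hmod
      exact List.getElem_append_left h'
    · have h'' : i + 1 = L.length := by omega
      rw [h'', Nat.mod_self] at hmod
      subst hmod
      rw [List.getElem_append_right h']
      simp [h'']
  rw [List.getElem_append_left hi, h2] at key
  exact key h

/-- The cyclic action on `ZMod L.length` in which the word `L` labels a cycle. -/
theorem exists_cycle_action {X : Type*} (L : List (X × Bool)) (hL : IsReduced (L ++ L))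
    (hne : L ≠ []) :
    ∃ τ : FreeGroup X →* Equiv.Perm (ZMod L.length),
      ∀ i (hi : i < L.length), τ (mk [L[i]]) (i + 1 : ZMod L.length) = (i : ZMod L.length) := by
  have : NeZero L.length := ⟨by simpa using hne⟩
  have hcast : ∀ i j, i < L.length → j < L.length → (i : ZMod L.length) = j → i = j := by
    intro i j hi hj h
    have := (ZMod.natCast_eq_natCast_iff' i j L.length).1 h
    rwa [Nat.mod_eq_of_lt hi, Nat.mod_eq_of_lt hj] at this
  obtain ⟨τ, hτ⟩ := exists_hom_perm_extending (V := ZMod L.length) (fun (x : X) u v =>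
    ∃ i, ∃ hi : i < L.length, (L[i] = (x, true) ∧ u = i + 1 ∧ v = i) ∨
      (L[i] = (x, false) ∧ u = i ∧ v = i + 1)) (by
    rintro x u v v' ⟨i, hi, h⟩ ⟨j, hj, h'⟩
    rcases h with ⟨h1, hu, rfl⟩ | ⟨h1, hu, rfl⟩ <;> rcases h' with ⟨h2, hu', rfl⟩ | ⟨h2, hu', rfl⟩
    · rw [hu] at hu'
      exact add_right_cancel hu'
    · have := not_inverse_of_isReduced_append_self hL hi hj (by rw [← hu', hu]) (by rw [h1, h2])
      simp [h1, h2] at this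
    · have := not_inverse_of_isReduced_append_self hL hj hi (by rw [← hu', hu]) (by rw [h1, h2])
      simp [h1, h2] at this
    · rw [← hu, ← hu']) (by
    rintro x v v' u ⟨i, hi, h⟩ ⟨j, hj, h'⟩
    rcases h with ⟨h1, rfl, hu⟩ | ⟨h1, rfl, hu⟩ <;> rcases h' with ⟨h2, rfl, hu'⟩ | ⟨h2, rfl, hu'⟩
    · rw [← hu, ← hu']
    · have := not_inverse_of_isReduced_append_self hL hj hi (by rw [← hu', hu]) (by rw [h1, h2])
      simp [h1, h2] at this
    · have := not_inverse_of_isReduced_append_self hL hi hj (by rw [← hu', hu]) (by rw [h1, h2])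
      simp [h1, h2] at this
    · rw [hu] at hu'
      exact add_right_cancel hu')
  refine ⟨τ, fun i hi => ?_⟩
  rcases hs : L[i] with ⟨x, _ | _⟩
  · rw [mk_singleton_false, _root_.map_inv, Equiv.Perm.inv_eq_iff_eq]
    exact (hτ x _ _ ⟨i, hi, Or.inr ⟨hs, rfl, rfl⟩⟩).symm
  · exact hτ x _ _ ⟨i, hi, Or.inl ⟨hs, rfl, rfl⟩⟩

/-- The signed number of times the letter `s`, read from `w`, crosses the edge labelled `x₀` that
starts at `w₀`. -/
def crossing {X W : Type*} [DecidableEq X] [DecidableEq W] (π : FreeGroup X →* Equiv.Perm W)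
    (x₀ : X) (w₀ : W) (s : X × Bool) (w : W) : ℤ :=
  if s.1 = x₀ ∧ (if s.2 then w else π (mk [s]) w) = w₀ then (if s.2 then 1 else -1) else 0

/-- The cyclic cover of an action that counts crossings of a given edge. -/
theorem exists_crossing_cover {X W : Type*} [DecidableEq X] [DecidableEq W]
    (π : FreeGroup X →* Equiv.Perm W) (x₀ : X) (w₀ : W) (k : ℕ) :
    ∃ φ : FreeGroup X →* Equiv.Perm (W × ZMod k), ∀ s w t,
      φ (mk [s]) (w, t) = (π (mk [s]) w, t + crossing π x₀ w₀ s w) := by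
  let φ : FreeGroup X →* Equiv.Perm (W × ZMod k) := lift fun x =>
    Equiv.prodShear (π (of x))
      (fun w => Equiv.addRight ((if x = x₀ ∧ w = w₀ then 1 else 0 : ℤ) : ZMod k))
  have hφ : ∀ x w t, φ (of x) (w, t) =
      (π (of x) w, t + ((if x = x₀ ∧ w = w₀ then 1 else 0 : ℤ) : ZMod k)) := by
    intro x w t
    simp only [φ, lift_apply_of]
    rfl
  refine ⟨φ, ?_⟩
  rintro ⟨x, _ | _⟩ w t
  · rw [mk_singleton_false, _root_.map_inv, Equiv.Perm.inv_eq_iff_eq, hφ]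
    simp only [crossing, mk_singleton_false, _root_.map_inv, Bool.false_eq_true, if_false,
      Equiv.Perm.coe_inv, Equiv.apply_symm_apply]
    split_ifs <;> simp
  · rw [mk_singleton_true, hφ]
    simp [crossing]

theorem fst_apply_eq_of_letters {X W V : Type*} {π : FreeGroup X →* Equiv.Perm W}
    {φ : FreeGroup X →* Equiv.Perm (W × V)}
    (h : ∀ s w t, (φ (mk [s]) (w, t)).1 = π (mk [s]) w) (g : FreeGroup X) (z : W × V) :
    (φ g z).1 = π g z.1 := by
  induction g using FreeGroup.induction_on generalizing z with
  | C1 => simp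
  | of x => exact h (x, true) _ _
  | inv_of x _ => exact h (x, false) _ _
  | mul a b ha hb => rw [_root_.map_mul, _root_.map_mul, Equiv.Perm.mul_apply, ha, hb]; rfl

set_option maxHeartbeats 1000000 in
/-- If a cyclically reduced word `L` labels a closed path at `p` that is not followed by `ι`, then a
finite quotient separates the conjugates of `L` that fix the base point from `H`. -/
theorem exists_normal_of_not_follows {X Y Z : Type*} [DecidableEq X] [Finite Y]
    [MulAction (FreeGroup X) Z] {ι : Y → Z} {ρ : FreeGroup X →* Equiv.Perm Y} {v₀ : Y}
    {H : Subgroup (FreeGroup X)} {S : Set (FreeGroup X)} (hH : Subgroup.closure S = H)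
    (hS : ∀ h ∈ S, Follows ι ρ h.toWord v₀) (hSfix : ∀ h ∈ S, ρ h v₀ = v₀)
    {L : List (X × Bool)} (hL : IsReduced (L ++ L)) {p : Y} (hp : ρ (mk L) p = p)
    (hbad : ¬ Follows ι ρ L p) :
    ∃ N : Subgroup (FreeGroup X), N.Normal ∧ N.FiniteIndex ∧
      ∀ g, ρ g p = v₀ → g * mk L * g⁻¹ ∉ H ⊔ N := by
  classical
  have hne : L ≠ [] := by
    rintro rfl
    exact hbad (follows_nil p)
  have : NeZero L.length := ⟨by simpa using hne⟩
  obtain ⟨i₀, hi₀, hedge⟩ := exists_not_follows hbad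
  obtain ⟨τ, hτ⟩ := exists_cycle_action L hL hne
  let π : FreeGroup X →* Equiv.Perm (Y × ZMod L.length) :=
    MonoidHom.mk' (fun g => Equiv.prodCongr (ρ g) (τ g)) (by
      intro a b
      ext1 ⟨y, q⟩
      simp)
  have hπ : ∀ g y q, π g (y, q) = (ρ g y, τ g q) := fun _ _ _ => rfl
  let w₀ : Y × ZMod L.length :=
    if L[i₀].2 then (ρ (mk (L.drop (i₀ + 1))) p, (i₀ : ZMod L.length) + 1)
    else (ρ (mk (L.drop i₀)) p, (i₀ : ZMod L.length))
  let ε : ℤ := if L[i₀].2 then 1 else -1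
  let M := Nat.card (Equiv.Perm (ZMod L.length))
  obtain ⟨φ, hφ⟩ := exists_crossing_cover π L[i₀].1 w₀ (M + 1)
  have hdrop : ∀ i (hi : i < L.length), mk (L.drop i) = mk [L[i]] * mk (L.drop (i + 1)) := by
    intro i hi
    rw [List.drop_eq_getElem_cons hi, mk_cons]
  have hw₀ : ι (ρ (of L[i₀].1) w₀.1) ≠ of L[i₀].1 • ι w₀.1 := by
    have hd := hdrop i₀ hi₀
    rcases hs : L[i₀] with ⟨x, _ | _⟩
    · rw [hs] at hedge hd
      simp only [w₀, hs, hd, mk_singleton_false, _root_.map_mul, _root_.map_inv,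
        Equiv.Perm.mul_apply, Bool.false_eq_true, if_false, Equiv.Perm.coe_inv,
        Equiv.apply_symm_apply] at hedge ⊢
      exact fun h => hedge (by rw [h, inv_smul_smul])
    · rw [hs] at hedge
      simpa [w₀, hs, mk_singleton_true] using hedge
  have hcross : ∀ s y q, ι (ρ (mk [s]) y) = mk [s] • ι y → crossing π L[i₀].1 w₀ s (y, q) = 0 := by
    rintro ⟨x, _ | _⟩ y q h
    · refine if_neg fun ⟨h1, h2⟩ => hw₀ ?_
      simp only [Bool.false_eq_true, if_false, hπ] at h1 h2
      rw [← h1, ← h2]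
      simp only [mk_singleton_false, _root_.map_inv, Equiv.Perm.coe_inv,
        Equiv.apply_symm_apply] at h ⊢
      rw [h, smul_inv_smul]
    · refine if_neg fun ⟨h1, h2⟩ => hw₀ ?_
      simp only [if_true] at h1 h2
      rw [← h1, ← h2]
      exact h
  have hfollow : ∀ w y q t, Follows ι ρ w y →
      φ (mk w) ((y, q), t) = ((ρ (mk w) y, τ (mk w) q), t) := by
    intro w y q t
    induction w with
    | nil => simp [← one_eq_mk]
    | cons s w ih =>
      intro h
      obtain ⟨h1, h2⟩ := follows_cons.1 h
      rw [mk_cons, _root_.map_mul, _root_.map_mul, _root_.map_mul, Equiv.Perm.mul_apply, ih h1, hφ,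
        hcross _ _ _ h2]
      simp [hπ]
  have hH' : ∀ h ∈ H, ∀ q t, φ h ((v₀, q), t) = ((v₀, τ h q), t) := by
    intro h hh
    rw [← hH] at hh
    induction hh using Subgroup.closure_induction with
    | mem x hx =>
      intro q t
      have := hfollow x.toWord v₀ q t (hS x hx)
      rwa [mk_toWord, hSfix x hx] at this
    | one => simp
    | mul a b _ _ ha hb =>
      intro q t
      rw [_root_.map_mul, _root_.map_mul, Equiv.Perm.mul_apply, hb, ha, Equiv.Perm.mul_apply]
    | inv a _ ha =>
      intro q t
      rw [_root_.map_inv, _root_.map_inv, Equiv.Perm.inv_eq_iff_eq, ha,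
        Equiv.Perm.coe_inv, Equiv.apply_symm_apply]
  have hstep : ∀ i (hi : i < L.length) y, y = ρ (mk (L.drop (i + 1))) p →
      crossing π L[i₀].1 w₀ L[i] (y, (i : ZMod L.length) + 1) = if i = i₀ then ε else 0 := by
    rintro i hi y rfl
    have hcast : (i : ZMod L.length) = i₀ → i = i₀ := by
      intro h
      have := (ZMod.natCast_eq_natCast_iff' i i₀ L.length).1 h
      rwa [Nat.mod_eq_of_lt hi, Nat.mod_eq_of_lt hi₀] at this
    split_ifs with h
    · subst h
      refine if_pos ⟨rfl, ?_⟩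
      simp only [w₀]
      split_ifs
      · rfl
      · rw [hπ, hτ, hdrop i hi, _root_.map_mul, Equiv.Perm.mul_apply]
    · refine if_neg fun ⟨h1, h2⟩ => h ?_
      rw [hπ, hτ] at h2
      rcases hb : L[i].2 with _ | _ <;> rcases hb₀ : L[i₀].2 with _ | _ <;>
        simp only [w₀, hb, hb₀, Bool.false_eq_true, if_false, if_true, Prod.mk.injEq] at h2
      · exact hcast h2.2
      · have := not_inverse_of_isReduced_append_self hL hi₀ hi h2.2 h1.symm
        simp [hb, hb₀] at this
      · have := not_inverse_of_isReduced_append_self hL hi hi₀ h2.2.symm h1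
        simp [hb, hb₀] at this
      · exact hcast (add_right_cancel h2.2)
  have hloop : ∀ t, φ (mk L) ((p, 0), t) = ((p, 0), t + ε) := by
    intro t
    suffices ∀ i (hi : i ≤ L.length), φ (mk (L.drop i)) ((p, 0), t) =
        ((ρ (mk (L.drop i)) p, (i : ZMod L.length)), t + ((if i ≤ i₀ then ε else 0 : ℤ) : ZMod _)) by
      simpa [hp] using this 0 (Nat.zero_le _)
    intro i hi
    induction hi using Nat.decreasingInduction with
    | self => simp [← one_eq_mk, hi₀]
    | of_succ i hi ih =>
      rw [hdrop i hi, _root_.map_mul, Equiv.Perm.mul_apply, ih, hφ, _root_.map_mul,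
        Equiv.Perm.mul_apply, hπ, Nat.cast_succ, hτ, hstep i hi _ rfl, add_assoc, ← Int.cast_add]
      congr 3
      split_ifs <;> omega
  have hpow : ∀ j : ℕ, ∀ t, (φ (mk L) ^ j) ((p, 0), t) = ((p, 0), t + j * ε) := by
    intro j
    induction j with
    | zero => simp
    | succ j ih =>
      intro t
      rw [pow_succ, Equiv.Perm.mul_apply, hloop, ih]
      push_cast
      congr 1
      ring
  refine ⟨φ.ker, inferInstance, Subgroup.finiteIndex_ker φ, fun g hg hmem => ?_⟩
  obtain ⟨h, hh, n, hn, hhn⟩ := Subgroup.mem_sup_of_normal_right.1 hmem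
  have hconj : φ g * φ (mk L) * (φ g)⁻¹ = φ h := by
    rw [← _root_.map_inv, ← _root_.map_mul, ← _root_.map_mul, ← hhn, _root_.map_mul, hn, mul_one]
  have hconjM : φ g * φ (mk L) ^ M * (φ g)⁻¹ = φ (h ^ M) := by
    rw [map_pow, ← hconj, conj_pow]
  have hfix : φ (h ^ M) (φ g ((p, 0), 0)) = φ g ((p, 0), 0) := by
    have h1 := fst_apply_eq_of_letters (φ := φ) (π := π) (fun s w t => by rw [hφ]) g ((p, 0), 0)
    rcases hz : φ g ((p, 0), 0) with ⟨⟨y, q⟩, t⟩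
    rw [hz, hπ, hg] at h1
    obtain rfl : y = v₀ := congrArg Prod.fst h1
    rw [hH' _ (H.pow_mem hh M), map_pow, pow_card_eq_one']
    rfl
  rw [← hconjM, Equiv.Perm.mul_apply, Equiv.Perm.mul_apply, Equiv.Perm.coe_inv,
    Equiv.symm_apply_apply] at hfix
  have h0 := (φ g).injective hfix
  rw [hpow] at h0
  have h1 : (M : ZMod (M + 1)) * ε = 0 := by simpa using h0
  have h2 : (M : ZMod (M + 1)) = -1 := by
    rw [eq_neg_iff_add_eq_zero]
    exact_mod_cast ZMod.natCast_self (M + 1)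
  have : Fact (1 < M + 1) := ⟨Nat.lt_add_of_pos_left Nat.card_pos⟩
  rw [h2] at h1
  simp only [ε] at h1
  split_ifs at h1 <;> simp at h1

theorem IsCyclicallyReduced.append_self {X : Type*} {L : List (X × Bool)}
    (h : IsCyclicallyReduced L) : IsReduced (L ++ L) := by
  simpa using (h.flatten_replicate 2).isReduced

theorem isReduced_append_self_rotate {X : Type*} {L M : List (X × Bool)}
    (h : IsReduced ((L ++ M) ++ (L ++ M))) (hne : L ++ M ≠ []) :
    IsReduced ((M ++ L) ++ (M ++ L)) := by
  have h1 : IsReduced (M ++ (L ++ M)) := h.infix ⟨L, [], by simp⟩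
  have h2 : IsReduced ((L ++ M) ++ L) := h.infix ⟨[], M, by simp⟩
  simpa using h1.append_overlap h2 hne

/-- If all closed paths at the orbit of `p` labelled by cyclically reduced conjugates of elements of
`A` are followed, then every element of `A` fixes `ι p` as soon as `A` contains a nontrivial
cyclically reduced element. -/
theorem smul_eq_of_forall_follows {X Y Z : Type*}
    [MulAction (FreeGroup X) Z] {ι : Y → Z} {ρ : FreeGroup X →* Equiv.Perm Y}
    {A : Subgroup (FreeGroup X)} {p : Y} (hp : ∀ a ∈ A, ρ a p = p)
    (hA : ∀ k L, IsReduced (L ++ L) → k⁻¹ * mk L * k ∈ A → Follows ι ρ L (ρ k p))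
    (U K : List (X × Bool)) (hK : IsCyclicallyReduced K)
    (hU : IsReduced (U ++ K ++ invRev U)) (k : FreeGroup X) (L : List (X × Bool))
    (hL : IsReduced (L ++ L)) (hLne : L ≠ []) (hLA : k⁻¹ * mk L * k ∈ A)
    (hUA : k⁻¹ * mk (U ++ K ++ invRev U) * k ∈ A) :
    mk (U ++ K ++ invRev U) • ι (ρ k p) = ι (ρ k p) := by
  have hfix : ∀ g, k⁻¹ * g * k ∈ A → ρ g (ρ k p) = ρ k p := by
    intro g hg
    have := hp _ hg
    rwa [_root_.map_mul, _root_.map_mul, _root_.map_inv, Equiv.Perm.mul_apply,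
      Equiv.Perm.mul_apply, Equiv.Perm.inv_eq_iff_eq] at this
  have hLf := hA k L hL hLA
  induction U generalizing k L with
  | nil =>
    have hf := hA k K hK.append_self (by simpa using hUA)
    have := hf.smul_eq
    rw [hfix _ (by simpa using hUA)] at this
    simpa using this.symm
  | cons u U ih =>
    have hinv : mk (invRev (u :: U)) = mk (invRev U) * (mk [u])⁻¹ := by
      rw [inv_mk, mul_mk]
      simp [invRev]
    have hword : mk (u :: U ++ K ++ invRev (u :: U)) =
        mk [u] * mk (U ++ K ++ invRev U) * (mk [u])⁻¹ := by
      rw [← mul_mk, hinv, List.cons_append, mk_cons, ← mul_mk (L₁ := U ++ K)]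
      group
    have hU' : IsReduced (U ++ K ++ invRev U) :=
      hU.infix ⟨[u], invRev [u], by simp [invRev]⟩
    -- it suffices to move along the first letter `u` of the conjugator
    have hrec : ∀ L', IsReduced (L' ++ L') → L' ≠ [] → mk L' = (mk [u])⁻¹ * mk L * mk [u] →
        ι (ρ (mk [u])⁻¹ (ρ k p)) = (mk [u])⁻¹ • ι (ρ k p) →
        mk (u :: U ++ K ++ invRev (u :: U)) • ι (ρ k p) = ι (ρ k p) := by
      intro L' hL' hne' hmk hι
      have hLA' : ((mk [u])⁻¹ * k)⁻¹ * mk L' * ((mk [u])⁻¹ * k) ∈ A := by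
        rw [hmk]
        convert hLA using 1
        group
      have := ih hU' ((mk [u])⁻¹ * k) L' hL' hne' hLA' (by
        rw [hword] at hUA
        convert hUA using 1
        group) (by
        intro g hg
        have := hp _ hg
        rwa [_root_.map_mul, _root_.map_mul, _root_.map_inv _ ((mk [u])⁻¹ * k),
          Equiv.Perm.mul_apply, Equiv.Perm.mul_apply, Equiv.Perm.inv_eq_iff_eq] at this)
        (hA _ _ hL' hLA')
      rw [_root_.map_mul, Equiv.Perm.mul_apply, hι] at this
      rw [hword, mul_smul, mul_smul, this, smul_inv_smul]
    have hmove : (∃ L', L = u :: L') ∨ (∃ L', L = L' ++ [(u.1, !u.2)]) ∨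
        IsReduced ((L ++ (u :: U ++ K ++ invRev (u :: U))) ++
          (L ++ (u :: U ++ K ++ invRev (u :: U)))) := by
      by_contra! hcon
      obtain ⟨hhead, hlast, hred⟩ := hcon
      refine hred ?_
      have h1 : IsReduced (L ++ (u :: U ++ K ++ invRev (u :: U))) := by
        refine List.isChain_append.2 ⟨hL.infix ⟨[], L, rfl⟩, hU, fun d hd c hc hdc => ?_⟩
        obtain rfl : u = c := by simpa using hc
        obtain ⟨L', rfl⟩ := List.getLast?_eq_some_iff.1 hd
        by_contra hne
        refine hlast L' ?_
        rw [← hdc, ← Bool.eq_not.2 hne]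
      refine List.isChain_append.2 ⟨h1, h1, fun d hd c hc hdc => ?_⟩
      obtain rfl : (u.1, !u.2) = d := by
        have hlast : L ++ (u :: U ++ K ++ invRev (u :: U)) =
            (L ++ (u :: U ++ K ++ invRev U)) ++ [(u.1, !u.2)] := by simp [invRev]
        rw [hlast, List.getLast?_concat] at hd
        simpa using hd
      obtain ⟨c', L', rfl⟩ := List.exists_cons_of_ne_nil hLne
      obtain rfl : c' = c := by simpa using hc
      by_contra hne
      refine hhead L' ?_
      have : u = c' := Prod.ext hdc (by simpa using hne)
      rw [this]
    rcases hmove with ⟨L', rfl⟩ | ⟨L', rfl⟩ | hW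
    · refine hrec (L' ++ [u]) (isReduced_append_self_rotate (L := [u]) (by simpa using hL) (by simp))
        (by simp) (by rw [mk_cons u L', ← mul_mk]; group) ?_
      have h1 := hLf.smul_eq
      have h2 := (follows_cons.1 hLf).1.smul_eq
      have h3 := hfix _ hLA
      rw [h3, mk_cons, mul_smul] at h1
      rw [mk_cons, _root_.map_mul, Equiv.Perm.mul_apply] at h3
      rw [eq_inv_smul_iff, h1, _root_.map_inv, ← h2]
      congr 2
      rw [Equiv.Perm.inv_eq_iff_eq, h3]
    · have hu : mk [(u.1, !u.2)] = (mk [u])⁻¹ := by rw [inv_mk]; rfl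
      refine hrec ((u.1, !u.2) :: L') (isReduced_append_self_rotate (M := [(u.1, !u.2)]) hL (by simp))
        (by simp) (by rw [mk_cons _ L', ← mul_mk, hu]; group) ?_
      rw [← hu]
      exact hLf _ (List.suffix_append _ _)
    · have hf := hA k _ hW (by
        have := A.mul_mem hLA hUA
        rw [← mul_mk]
        convert this using 1
        group)
      have := hf _ (List.suffix_append _ _)
      rwa [hfix _ hUA, eq_comm] at this

theorem mk_conjugator_mul_mk_reduceCyclically {X : Type*} [DecidableEq X] (a : FreeGroup X) :
    mk (reduceCyclically.conjugator a.toWord) * mk (reduceCyclically a.toWord) *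
      (mk (reduceCyclically.conjugator a.toWord))⁻¹ = a := by
  rw [inv_mk, mul_mk, mul_mk, reduceCyclically.conj_conjugator_reduceCyclically, mk_toWord]

theorem reduceCyclically_toWord_ne_nil {X : Type*} [DecidableEq X] {a : FreeGroup X} (ha : a ≠ 1) :
    reduceCyclically a.toWord ≠ [] := by
  intro h
  have := mk_conjugator_mul_mk_reduceCyclically a
  rw [h, ← one_eq_mk, mul_one, mul_inv_cancel] at this
  exact ha this.symm

theorem exists_fixed_point_of_forall_follows {X Y Z : Type*} [DecidableEq X]
    [MulAction (FreeGroup X) Z] {ι : Y → Z} {ρ : FreeGroup X →* Equiv.Perm Y}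
    {A : Subgroup (FreeGroup X)} {p : Y} (hp : ∀ a ∈ A, ρ a p = p)
    (hA : ∀ k L, IsReduced (L ++ L) → k⁻¹ * mk L * k ∈ A → Follows ι ρ L (ρ k p)) :
    ∃ z : Z, ∀ a ∈ A, a • z = z := by
  by_cases hbot : ∀ a ∈ A, a = 1
  · exact ⟨ι p, fun a ha => by rw [hbot a ha, one_smul]⟩
  push Not at hbot
  obtain ⟨a, ha, ha1⟩ := hbot
  let k : FreeGroup X := (mk (reduceCyclically.conjugator a.toWord))⁻¹
  refine ⟨k⁻¹ • ι (ρ k p), fun b hb => ?_⟩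
  have hword := reduceCyclically.conj_conjugator_reduceCyclically (k * b * k⁻¹).toWord
  have := smul_eq_of_forall_follows hp hA
    (reduceCyclically.conjugator (k * b * k⁻¹).toWord) (reduceCyclically (k * b * k⁻¹).toWord)
    (reduceCyclically.isCyclicallyReduced isReduced_toWord)
    (by rw [hword]; exact isReduced_toWord) k (reduceCyclically a.toWord)
    (reduceCyclically.isCyclicallyReduced isReduced_toWord).append_self
    (reduceCyclically_toWord_ne_nil ha1)
    (by simpa only [k, inv_inv, mk_conjugator_mul_mk_reduceCyclically] using ha)
    (by rw [hword, mk_toWord]; convert hb using 1; group)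
  rw [hword, mk_toWord, mul_smul, mul_smul, ← eq_inv_smul_iff] at this
  exact this

/-- Subgroup into-conjugacy separability of free groups: if `H₁` is not conjugate into the finitely
generated subgroup `H₂`, then this is visible in a finite quotient. -/
theorem exists_normal_of_not_conj_le {X : Type*} {H₁ H₂ : Subgroup (FreeGroup X)} (hfg : H₂.FG)
    (h : ∀ c, ¬ ∀ a ∈ H₁, c * a * c⁻¹ ∈ H₂) :
    ∃ N : Subgroup (FreeGroup X), N.Normal ∧ N.FiniteIndex ∧
      ∀ c, ¬ ∀ a ∈ H₁, c * a * c⁻¹ ∈ H₂ ⊔ N := by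
  classical
  obtain ⟨S, hS⟩ := hfg
  obtain ⟨n, ι, ρ, v₀, hι, hv₀, hfollow⟩ := exists_finite_action H₂ S S.finite_toSet
  have hSfix : ∀ h ∈ (S : Set (FreeGroup X)), ρ h v₀ = v₀ := by
    intro s hs
    have hsH : s ∈ H₂ := hS ▸ Subgroup.subset_closure hs
    apply hι
    have := (hfollow s hs).smul_eq
    rw [mk_toWord] at this
    rw [this, hv₀, MulAction.Quotient.smul_mk, QuotientGroup.eq]
    simpa using hsH
  have hfix : ∀ g ∈ H₂, ρ g v₀ = v₀ := by
    intro g hg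
    rw [← hS] at hg
    induction hg using Subgroup.closure_induction with
    | mem x hx => exact hSfix x hx
    | one => simp
    | mul a b _ _ ha hb => rw [_root_.map_mul, Equiv.Perm.mul_apply, hb, ha]
    | inv a _ ha => rw [_root_.map_inv, Equiv.Perm.inv_eq_iff_eq, ha]
  have key : ∀ p : Fin n, ∃ N : Subgroup (FreeGroup X), N.Normal ∧ N.FiniteIndex ∧
      ∀ c, ρ c p = v₀ → ¬ ∀ a ∈ H₁, c * a * c⁻¹ ∈ H₂ ⊔ N := by
    intro p
    by_cases hp : ∀ a ∈ H₁, ρ a p = p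
    · by_cases hA : ∀ k L, IsReduced (L ++ L) → k⁻¹ * mk L * k ∈ H₁ → Follows ι ρ L (ρ k p)
      · obtain ⟨z, hz⟩ := exists_fixed_point_of_forall_follows hp hA
        obtain ⟨g, rfl⟩ := QuotientGroup.mk_surjective z
        refine (h g⁻¹ fun a ha => ?_).elim
        have := hz a ha
        rw [MulAction.Quotient.smul_mk, eq_comm, QuotientGroup.eq] at this
        simpa [mul_assoc] using this
      · push Not at hA
        obtain ⟨k, L, hL, hLA, hbad⟩ := hA
        have hpk : ρ (mk L) (ρ k p) = ρ k p := by
          have := hp _ hLA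
          rwa [_root_.map_mul, _root_.map_mul, _root_.map_inv, Equiv.Perm.mul_apply,
            Equiv.Perm.mul_apply, Equiv.Perm.inv_eq_iff_eq] at this
        obtain ⟨N, hN, hNf, hsep⟩ := exists_normal_of_not_follows hS hfollow hSfix hL hpk hbad
        refine ⟨N, hN, hNf, fun c hc hall => hsep (c * k⁻¹) ?_ ?_⟩
        · rw [← Equiv.Perm.mul_apply, ← _root_.map_mul, inv_mul_cancel_right, hc]
        · convert hall _ hLA using 1
          group
    · refine ⟨ρ.ker, inferInstance, Subgroup.finiteIndex_ker ρ, fun c hc hall => hp fun a ha => ?_⟩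
      have hle : H₂ ⊔ ρ.ker ≤ (MulAction.stabilizer (Equiv.Perm (Fin n)) v₀).comap ρ :=
        sup_le hfix fun g hg => by
          rw [Subgroup.mem_comap, MonoidHom.mem_ker.1 hg]
          exact one_mem _
      have : ρ (c * a * c⁻¹) v₀ = v₀ := hle (hall a ha)
      rw [← hc, ← Equiv.Perm.mul_apply, ← _root_.map_mul, inv_mul_cancel_right, _root_.map_mul,
        Equiv.Perm.mul_apply] at this
      exact (ρ c).injective this
  choose N hN hNf hsep using key
  refine ⟨⨅ p, N p, Subgroup.normal_iInf_normal hN, Subgroup.finiteIndex_iInf hNf, fun c hall => ?_⟩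
  refine hsep (ρ c⁻¹ v₀) c ?_ fun a ha => sup_le_sup_left (iInf_le N _) H₂ (hall a ha)
  rw [← Equiv.Perm.mul_apply, ← _root_.map_mul]
  simp

/-- A finitely generated subgroup of a free group is not properly contained in a conjugate. -/
theorem le_of_conj_le {X : Type*} {H : Subgroup (FreeGroup X)} (hfg : H.FG) {c : FreeGroup X}
    (hc : ∀ h ∈ H, c * h * c⁻¹ ∈ H) {k : FreeGroup X} (hk : c * k * c⁻¹ ∈ H) : k ∈ H := by
  classical
  obtain ⟨S, hS⟩ := hfg
  obtain ⟨n, ι, ρ, v₀, hι, hv₀, hfollow⟩ :=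
    exists_finite_action H (insert k S) (S.finite_toSet.insert k)
  have hfix_iff : ∀ g ∈ insert k (S : Set (FreeGroup X)), (ρ g v₀ = v₀ ↔ g ∈ H) := by
    intro g hg
    have := (hfollow g hg).smul_eq
    rw [mk_toWord] at this
    rw [← hι.eq_iff, this, hv₀, MulAction.Quotient.smul_mk, eq_comm, QuotientGroup.eq]
    simp
  have hle : H ≤ (MulAction.stabilizer (Equiv.Perm (Fin n)) v₀).comap ρ := by
    rw [← hS, Subgroup.closure_le]
    exact fun s hs => (hfix_iff s (Set.mem_insert_of_mem _ hs)).2 (hS ▸ Subgroup.subset_closure hs)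
  refine (hfix_iff k (Set.mem_insert _ _)).1 ?_
  -- conjugation by `ρ c` permutes the finite image of `H`
  have hmaps : Set.MapsTo (MulAut.conj (ρ c)) (H.map ρ) (H.map ρ) := by
    rintro _ ⟨g, hg, rfl⟩
    exact ⟨_, hc g hg, by simp⟩
  have hbij := ((Set.toFinite (H.map ρ : Set (Equiv.Perm (Fin n)))).injOn_iff_bijOn_of_mapsTo
    hmaps).1 (MulAut.conj (ρ c)).injective.injOn
  obtain ⟨_, ⟨h, hh, rfl⟩, hconj⟩ := hbij.surjOn ⟨c * k * c⁻¹, hk, rfl⟩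
  have hρ : ρ h = ρ k := (MulAut.conj (ρ c)).injective (by rw [hconj]; simp)
  rw [← hρ]
  exact hle hh

end FreeGroup

/-- Every free group is subgroup conjugacy separable (SCS). -/
theorem freeGroup_scs (X : Type*) : SCS (FreeGroup X) := by
  intro H₁ H₂ hfg₁ hfg₂ hconj
  -- a finite quotient refuting one inclusion up to conjugacy suffices
  suffices ∃ N : Subgroup (FreeGroup X), N.Normal ∧ N.FiniteIndex ∧
      ((∀ c, ¬ ∀ a ∈ H₁, c * a * c⁻¹ ∈ H₂ ⊔ N) ∨ (∀ c, ¬ ∀ a ∈ H₂, c * a * c⁻¹ ∈ H₁ ⊔ N)) by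
    obtain ⟨N, hN, hNf, hsep⟩ := this
    have hfin : Finite (FreeGroup X ⧸ N) := inferInstance
    let e : Shrink.{0} (FreeGroup X ⧸ N) ≃* FreeGroup X ⧸ N := Shrink.mulEquiv
    let φ : FreeGroup X →* Shrink.{0} (FreeGroup X ⧸ N) :=
      e.symm.toMonoidHom.comp (QuotientGroup.mk' N)
    have hφ : Function.Surjective φ :=
      e.symm.surjective.comp (QuotientGroup.mk'_surjective N)
    have hker : ∀ x y, φ x = φ y → x⁻¹ * y ∈ N := fun x y hxy =>
      QuotientGroup.eq.1 (e.symm.injective hxy)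
    have hmem : ∀ (H : Subgroup (FreeGroup X)) x, φ x ∈ H.map φ → x ∈ H ⊔ N := by
      rintro H x ⟨h, hh, hx⟩
      rw [← mul_inv_cancel_left h x]
      exact mul_mem (Subgroup.mem_sup_left hh) (Subgroup.mem_sup_right (hker h x hx))
    refine ⟨_, inferInstance, Finite.of_surjective _ e.symm.surjective, φ, hφ, ?_⟩
    rintro ⟨q, hq⟩
    obtain ⟨c, rfl⟩ := hφ q
    rcases hsep with hsep | hsep
    · refine hsep c⁻¹ fun a ha => hmem _ _ ?_
      rw [← hq]
      exact ⟨φ a, ⟨a, ha, rfl⟩, by simp⟩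
    · refine hsep c fun b hb => hmem _ _ ?_
      have : φ b ∈ H₂.map φ := ⟨b, hb, rfl⟩
      rw [← hq] at this
      obtain ⟨_, ⟨a, ha, rfl⟩, hab⟩ := this
      refine ⟨a, ha, ?_⟩
      rw [map_mul, map_mul, map_inv, ← hab]
      simp [mul_assoc]
  by_cases h₁ : ∀ c, ¬ ∀ a ∈ H₁, c * a * c⁻¹ ∈ H₂
  · obtain ⟨N, hN, hNf, hsep⟩ := FreeGroup.exists_normal_of_not_conj_le hfg₂ h₁
    exact ⟨N, hN, hNf, Or.inl hsep⟩
  by_cases h₂ : ∀ c, ¬ ∀ a ∈ H₂, c * a * c⁻¹ ∈ H₁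
  · obtain ⟨N, hN, hNf, hsep⟩ := FreeGroup.exists_normal_of_not_conj_le hfg₁ h₂
    exact ⟨N, hN, hNf, Or.inr hsep⟩
  push Not at h₁ h₂
  obtain ⟨c, hc⟩ := h₁
  obtain ⟨d, hd⟩ := h₂
  refine (hconj ⟨c⁻¹, le_antisymm ?_ fun b hb => ?_⟩).elim
  · rintro _ ⟨a, ha, rfl⟩
    simpa using hc a ha
  · refine ⟨c⁻¹ * b * c, FreeGroup.le_of_conj_le hfg₁ (c := d * c) (fun a ha => ?_) ?_, ?_⟩
    · convert hd _ (hc a ha) using 1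
      group
    · convert hd b hb using 1
      group
    · simp [mul_assoc]
end

section
/- (Takahasi) Let F_n be the free group of finite rank n, and let H₁ < H₂ < H₃ < ⋯ be a strictly ascending infinite chain of finitely generated subgroups of F_n. Then the sequence of ranks of the groups H_i is unbounded: for every natural number k there exists an index i such that the rank of H_i exceeds k. -/
theorem FreeGroupBasis.closure_range_eq_top {ι G : Type*} [Group G] (b : FreeGroupBasis ι G) :
    Subgroup.closure (Set.range b) = ⊤ := by
  have hrange : Set.range b = b.repr.symm.toMonoidHom '' Set.range FreeGroup.of := by
    rw [← Set.range_comp]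
    rfl
  rw [hrange, ← MonoidHom.map_closure, FreeGroup.closure_range_of,
    Subgroup.map_top_of_surjective _ b.repr.symm.surjective]

/-- If a finitely generated subgroup `K` of a free group contains `m` distinct elements of a basis,
then `m ≤ Group.rank K`. -/
theorem FreeGroupBasis.le_rank_of_mem {ι G : Type*} [Group G] (b : FreeGroupBasis ι G) {m : ℕ}
    (f : Fin m ↪ ι) (K : Subgroup G) [Group.FG K] (hK : ∀ j, b (f j) ∈ K) : m ≤ Group.rank K := by
  classical
  let V := Fin m → Multiplicative (ZMod 2)
  let φ : G →* V := b.lift fun x j => if x = f j then Multiplicative.ofAdd 1 else 1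
  have hφ (j : Fin m) : φ (b (f j)) = Pi.mulSingle j (Multiplicative.ofAdd 1) := by
    ext l
    simp [φ, Pi.mulSingle_apply, eq_comm]
  have hsurj : Function.Surjective (φ.comp K.subtype) := by
    rw [← MonoidHom.range_eq_top, eq_top_iff]
    intro v _
    refine Subgroup.pi_mem_of_mulSingle_mem v fun j => ⟨⟨b (f j), hK j⟩ ^ (v j).toAdd.val, ?_⟩
    rw [map_pow]
    simp only [MonoidHom.comp_apply, Subgroup.subtype_apply, hφ]
    rw [← Pi.mulSingle_pow, ← ofAdd_nsmul]
    simp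
  have : Group.FG V := Group.fg_of_surjective hsurj
  have hexp (v : V) : v ^ 2 = 1 := by
    ext j
    exact congrArg Multiplicative.ofAdd (CharTwo.two_nsmul (v j).toAdd)
  have hdvd := card_dvd_exponent_pow_rank' V hexp
  have hcard : Nat.card V = 2 ^ m := by simp [V]
  rw [hcard, Nat.pow_dvd_pow_iff_le_right'] at hdvd
  exact hdvd.trans (Group.rank_le_of_surjective _ hsurj)

/-- Finitely many elements of the supremum of an ascending chain lie in one member. -/
theorem Subgroup.exists_forall_mem_of_monotone {ι G : Type*} [Finite ι] [Group G]
    {H : ℕ → Subgroup G} (hH : Monotone H) (g : ι → G) (hg : ∀ j, g j ∈ ⨆ i, H i) :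
    ∃ i, ∀ j, g j ∈ H i := by
  have h (j : ι) : ∃ i, g j ∈ H i := (Subgroup.mem_iSup_of_directed hH.directed_le).1 (hg j)
  choose i hi using h
  obtain ⟨N, hN⟩ := Finite.exists_le i
  exact ⟨N, fun j => hH (hN j) (hi j)⟩

/-- (Takahasi) If `H₁ < H₂ < H₃ < ⋯` is a strictly ascending infinite chain of
finitely generated subgroups of the free group of finite rank `n`, then the
sequence of ranks of the groups `H i` is unbounded. -/
theorem takahasi_ranks_unbounded (n : ℕ) (H : ℕ → Subgroup (FreeGroup (Fin n)))
    (hchain : ∀ i, H i < H (i + 1)) (hfg : ∀ i, (H i).FG) :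
    ∀ k : ℕ, ∃ i, k <
      @Group.rank (H i) _ ((Group.fg_iff_subgroup_fg (H i)).mpr (hfg i)) := by
  intro k
  have hmono : StrictMono H := strictMono_nat_of_lt_succ hchain
  let U := ⨆ i, H i
  let b := IsFreeGroup.basis U
  have hinf : Infinite (IsFreeGroup.Generators U) := by
    by_contra hfin
    rw [not_infinite_iff_finite] at hfin
    obtain ⟨N, hN⟩ := Subgroup.exists_forall_mem_of_monotone hmono.monotone
      (fun x => (b x : FreeGroup (Fin n))) fun x => (b x).2
    have htop : (H N).subgroupOf U = ⊤ := by
      rw [eq_top_iff, ← b.closure_range_eq_top, Subgroup.closure_le]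
      rintro _ ⟨x, rfl⟩
      exact hN x
    exact (hchain N).not_ge ((le_iSup H (N + 1)).trans (Subgroup.subgroupOf_eq_top.1 htop))
  let f : Fin (k + 1) ↪ IsFreeGroup.Generators U :=
    Fin.valEmbedding.trans (Infinite.natEmbedding _)
  obtain ⟨N, hN⟩ := Subgroup.exists_forall_mem_of_monotone hmono.monotone
    (fun j => (b (f j) : FreeGroup (Fin n))) fun j => (b (f j)).2
  refine ⟨N, ?_⟩
  have hfgN : Group.FG (H N) := (Group.fg_iff_subgroup_fg (H N)).mpr (hfg N)
  let e : (H N).subgroupOf U ≃* H N := Subgroup.subgroupOfEquivOfLe (le_iSup H N)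
  have : Group.FG ((H N).subgroupOf U) := Group.fg_of_surjective (f := e.symm.toMonoidHom) e.symm.surjective
  rw [← Group.rank_congr e]
  exact b.le_rank_of_mem f _ hN
end

section
/- Finitely generated free groups admit no expanding automorphisms: if F is a free group of finite rank and α is an automorphism of F, then there is no finitely generated subgroup H of F with H < α(H) a strict inclusion. -/
open Equiv

/-- A partial action of a free group on a finite subset of a set it acts on extends to an action:
each generator moves a point of the subset as before whenever the image stays in the subset. -/
lemma FreeGroup.exists_hom_perm_extending_s6 {X Y : Type*} [MulAction (FreeGroup X) Y]
    (P : Set Y) [Finite P] :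
    ∃ φ : FreeGroup X →* Perm P, ∀ (x : X) (p q : P),
      FreeGroup.of x • (p : Y) = q → φ (FreeGroup.of x) p = q := by
  classical
  have := Fintype.ofFinite P
  have key : ∀ x : X, ∃ σ : Perm P, ∀ p q : P, FreeGroup.of x • (p : Y) = q → σ p = q := by
    intro x
    let f : {p : P // FreeGroup.of x • (p : Y) ∈ P} → P := fun p => ⟨_, p.2⟩
    have hf : Function.Injective f := by
      intro a b h
      exact Subtype.ext (Subtype.ext (MulAction.injective _ (congrArg Subtype.val h)))
    let e := Equiv.ofInjective f hf
    refine ⟨Equiv.extendSubtype (p := fun p : P => FreeGroup.of x • (p : Y) ∈ P)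
      (q := fun q => q ∈ Set.range f) e, fun p q h => ?_⟩
    have hp : FreeGroup.of x • (p : Y) ∈ P := h ▸ q.2
    rw [Equiv.extendSubtype_apply_of_mem e p hp]
    exact Subtype.ext h
  choose σ hσ using key
  exact ⟨FreeGroup.lift σ, fun x p q h => by simpa using hσ x p q h⟩

/-- If `φ` extends a partial action on `P`, then `φ` agrees with the original action along every
word whose trajectory stays in `P`. -/
lemma FreeGroup.hom_perm_apply_eq_smul {X Y : Type*} [MulAction (FreeGroup X) Y]
    {P : Set Y} {φ : FreeGroup X →* Perm P}
    (hφ : ∀ (x : X) (p q : P), FreeGroup.of x • (p : Y) = q → φ (FreeGroup.of x) p = q)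
    (p : P) (L : List (X × Bool)) (hL : ∀ T, T <:+ L → FreeGroup.mk T • (p : Y) ∈ P) :
    (φ (FreeGroup.mk L) p : Y) = FreeGroup.mk L • (p : Y) := by
  induction L with
  | nil => simp [← FreeGroup.one_eq_mk]
  | cons a L ih =>
    have ih := ih fun T hT => hL T (hT.trans (List.suffix_cons a L))
    have hmem := hL _ List.suffix_rfl
    obtain ⟨x, b⟩ := a
    have hcons : FreeGroup.mk ((x, b) :: L) = FreeGroup.mk [(x, b)] * FreeGroup.mk L := by
      simp [FreeGroup.mul_mk]
    rw [hcons, mul_smul] at hmem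
    rw [hcons, mul_smul, _root_.map_mul, Perm.mul_apply]
    cases b with
    | true =>
      exact congrArg Subtype.val (hφ x _ ⟨_, hmem⟩ (by rw [ih]; rfl))
    | false =>
      have hinv : FreeGroup.mk [(x, false)] = (FreeGroup.of x)⁻¹ := by
        simp [FreeGroup.of, FreeGroup.inv_mk, FreeGroup.invRev]
      rw [hinv] at hmem ⊢
      have h := hφ x ⟨_, hmem⟩ (φ (FreeGroup.mk L) p) (by rw [ih]; simp)
      rw [_root_.map_inv, ← h]
      simp

/-- Marshall Hall's theorem: a finitely generated subgroup of a free group is separated from any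
element outside it by an action on a finite set. -/
theorem FreeGroup.exists_finite_perm_separating {X : Type*} {H : Subgroup (FreeGroup X)}
    (hH : H.FG) {g : FreeGroup X} (hg : g ∉ H) :
    ∃ (P : Set (FreeGroup X ⧸ H)) (_ : Finite P) (φ : FreeGroup X →* Perm P) (p : P),
      (∀ h ∈ H, φ h p = p) ∧ φ g p ≠ p := by
  classical
  obtain ⟨S, rfl⟩ := hH
  set H := Subgroup.closure (S : Set (FreeGroup X))
  let y : FreeGroup X ⧸ H := ((1 : FreeGroup X) : FreeGroup X ⧸ H)
  let P : Set (FreeGroup X ⧸ H) :=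
    ⋃ w ∈ insert g S, (fun T => FreeGroup.mk T • y) '' {T | T ∈ w.toWord.tails}
  have hP : P.Finite :=
    (Finset.finite_toSet (insert g S)).biUnion fun w _ => (List.finite_toSet _).image _
  have htail : ∀ w ∈ insert g S, ∀ T, T <:+ w.toWord → FreeGroup.mk T • y ∈ P := by
    intro w hw T hT
    exact Set.mem_biUnion hw ⟨T, by simpa using hT, rfl⟩
  have hy : y ∈ P := by
    have := htail g (Finset.mem_insert_self _ _) [] List.nil_suffix
    rwa [← FreeGroup.one_eq_mk, one_smul] at this
  have : Finite P := hP
  obtain ⟨φ, hφ⟩ := FreeGroup.exists_hom_perm_extending_s6 (X := X) P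
  have hval : ∀ w ∈ insert g S, (φ w ⟨y, hy⟩ : FreeGroup X ⧸ H) = w • y := by
    intro w hw
    simpa [FreeGroup.mk_toWord] using
      FreeGroup.hom_perm_apply_eq_smul hφ ⟨y, hy⟩ w.toWord (htail w hw)
  have hfix : ∀ w, w • y = y ↔ w ∈ H := fun w => by
    change ((w * 1 : FreeGroup X) : FreeGroup X ⧸ H) = ((1 : FreeGroup X) : FreeGroup X ⧸ H) ↔ _
    rw [mul_one, eq_comm, QuotientGroup.eq]
    simp
  refine ⟨P, this, φ, ⟨y, hy⟩, fun h hh => ?_, fun h => hg ?_⟩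
  · have hle : H ≤ (MulAction.stabilizer (Perm P) (⟨y, hy⟩ : P)).comap φ :=
      (Subgroup.closure_le _).2 fun s hs => Subtype.ext <|
        (hval s (Finset.mem_insert_of_mem hs)).trans ((hfix s).2 (Subgroup.subset_closure hs))
    exact hle hh
  · rw [← hfix, ← hval g (Finset.mem_insert_self _ _), h]

/-- Some positive power of an automorphism of a group `G` is invisible to all homomorphisms from
`G` to a given group, provided there are only finitely many of these. -/
lemma MulAut.exists_pow_comp_eq {G K : Type*} [Group G] [Group K] [Finite (G →* K)]
    (α : MulAut G) : ∃ m : ℕ, 0 < m ∧ ∀ (φ : G →* K) (x : G), φ ((α ^ m) x) = φ x := by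
  let e : Perm (G →* K) :=
    { toFun := fun φ => φ.comp α.toMonoidHom
      invFun := fun φ => φ.comp α.symm.toMonoidHom
      left_inv := fun φ => by ext; simp
      right_inv := fun φ => by ext; simp }
  have he : ∀ (m : ℕ) (φ : G →* K) (x : G), (e ^ m) φ x = φ ((α ^ m) x) := by
    intro m
    induction m with
    | zero => simp
    | succ m ih =>
      intro φ x
      rw [pow_succ, Perm.mul_apply, ih, pow_succ']
      rfl
  refine ⟨orderOf e, orderOf_pos e, fun φ x => ?_⟩
  rw [← he, pow_orderOf_eq_one, Perm.one_apply]

/-- Finitely generated free groups admit no expanding automorphisms: for any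
automorphism `α` of a free group of finite rank, there is no finitely generated
subgroup `H` with `H < α(H)` a strict inclusion. -/
theorem freeGroup_no_expanding_automorphism (X : Type*) [Finite X]
    (α : MulAut (FreeGroup X)) :
    ¬ ∃ H : Subgroup (FreeGroup X), H.FG ∧ H < H.map α.toMonoidHom := by
  rintro ⟨H, hfg, hlt⟩
  obtain ⟨g, hg, hgH⟩ := SetLike.exists_of_lt hlt
  obtain ⟨P, _, φ, p, hfix, hmove⟩ := FreeGroup.exists_finite_perm_separating hfg hgH
  have : Finite (FreeGroup X →* Perm P) := Finite.of_equiv _ FreeGroup.lift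
  obtain ⟨m, hm, hφ⟩ := MulAut.exists_pow_comp_eq (K := Perm P) α
  have hpow : ∀ n : ℕ, ∀ x ∈ H.map α.toMonoidHom, ∃ h ∈ H, (α ^ (n + 1)) h = x := by
    intro n
    induction n with
    | zero =>
      rintro _ ⟨h, hh, rfl⟩
      exact ⟨h, hh, by simp⟩
    | succ n ih =>
      rintro _ ⟨h, hh, rfl⟩
      obtain ⟨k, hk, rfl⟩ := ih h (hlt.le hh)
      exact ⟨k, hk, by rw [pow_succ' α (n + 1)]; rfl⟩
  obtain ⟨h, hh, rfl⟩ := hpow (m - 1) g hg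
  rw [Nat.sub_add_cancel hm, hφ] at hmove
  exact hmove (hfix h hh)
end

section
/- Let H₁ and H₂ be two finitely generated subgroups of a group G, and assume that G admits no expanding inner automorphisms. If g, h ∈ G are elements with H₂^g ≤ H₁ and H₁^h ≤ H₂, then in fact H₂^g = H₁ and H₁^h = H₂. In particular, if H₂ is conjugate into H₁ and H₁ is conjugate into H₂, then H₁ and H₂ are conjugate in G. -/
theorem Subgroup.conjBy_conjBy {G : Type*} [Group G] (A : Subgroup G) (c d : G) :
    (A.conjBy c).conjBy d = A.conjBy (c * d) := by
  rw [Subgroup.conjBy, Subgroup.conjBy, Subgroup.conjBy, Subgroup.map_map, mul_inv_rev, map_mul]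
  rfl

theorem Subgroup.conjBy_one {G : Type*} [Group G] (A : Subgroup G) : A.conjBy 1 = A := by
  rw [Subgroup.conjBy, inv_one, map_one]
  exact Subgroup.map_id A

theorem Subgroup.conjBy_mono {G : Type*} [Group G] {A B : Subgroup G} (hAB : A ≤ B) (c : G) :
    A.conjBy c ≤ B.conjBy c :=
  Subgroup.map_mono hAB

theorem Subgroup.conjBy_eq_of_conjBy_le {G : Type*} [Group G]
    (hne : ∀ (f : G) (H : Subgroup G), H.FG → ¬ H < H.conjBy f)
    {A B : Subgroup G} (hA : A.FG) {g h : G} (hg : B.conjBy g ≤ A) (hh : A.conjBy h ≤ B) :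
    A.conjBy h = B := by
  have hAB : A ≤ B.conjBy h⁻¹ := by
    simpa [Subgroup.conjBy_conjBy, Subgroup.conjBy_one] using Subgroup.conjBy_mono hh h⁻¹
  have hBA : B.conjBy h⁻¹ ≤ A.conjBy (g⁻¹ * h⁻¹) := by
    simpa [Subgroup.conjBy_conjBy] using Subgroup.conjBy_mono hg (g⁻¹ * h⁻¹)
  have hA' : A = A.conjBy (g⁻¹ * h⁻¹) :=
    (hAB.trans hBA).eq_of_not_lt (hne _ A hA)
  have hAB' : A = B.conjBy h⁻¹ := le_antisymm hAB (hBA.trans hA'.ge)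
  rw [hAB', Subgroup.conjBy_conjBy, inv_mul_cancel, Subgroup.conjBy_one]

/-- Let `H₁` and `H₂` be finitely generated subgroups of a group `G` admitting no
expanding inner automorphisms. If `H₂^g ≤ H₁` and `H₁^h ≤ H₂`, then in fact
`H₂^g = H₁` and `H₁^h = H₂`; in particular `H₁` and `H₂` are conjugate. -/
theorem conj_into_both_ways_eq {G : Type*} [Group G]
    (hne : ∀ (f : G) (H : Subgroup G), H.FG → ¬ H < H.conjBy f)
    (H₁ H₂ : Subgroup G) (h1 : H₁.FG) (h2 : H₂.FG)
    (g h : G) (hg : H₂.conjBy g ≤ H₁) (hh : H₁.conjBy h ≤ H₂) :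
    H₂.conjBy g = H₁ ∧ H₁.conjBy h = H₂ ∧ ∃ c : G, H₁.conjBy c = H₂ := by
  have hAB := Subgroup.conjBy_eq_of_conjBy_le hne h1 hg hh
  exact ⟨Subgroup.conjBy_eq_of_conjBy_le hne h2 hh hg, hAB, h, hAB⟩
end

section
/- Suppose a group G admits no expanding inner automorphisms and is subgroup into conjugacy separable (SICS). Then G is subgroup conjugacy separable (SCS). -/
/-- A group `G` is subgroup into conjugacy separable (SICS) if for any two finitely
generated subgroups `H₁`, `H₂` of `G` such that `H₂` is not conjugate into `H₁`,
there is a finite quotient of `G` in which the image of `H₂` is not conjugate into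
the image of `H₁`. -/
def SICS (G : Type*) [Group G] : Prop :=
  ∀ H₁ H₂ : Subgroup G, H₁.FG → H₂.FG → (¬ ∃ c : G, H₂.conjBy c ≤ H₁) →
    ∃ (Q : Type) (_ : Group Q) (_ : Finite Q) (φ : G →* Q),
      Function.Surjective φ ∧ ¬ ∃ q : Q, (H₂.map φ).conjBy q ≤ H₁.map φ

namespace Subgroup

variable {G : Type*} [Group G]

theorem conjBy_conjBy_s9 (A : Subgroup G) (a b : G) :
    (A.conjBy a).conjBy b = A.conjBy (a * b) := by
  simp only [conjBy, map_map]
  congr 1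
  ext x
  simp [mul_assoc]

theorem conjBy_one_s9 (A : Subgroup G) : A.conjBy 1 = A := by
  ext x
  simp [conjBy]

theorem conjBy_mono_s9 {A B : Subgroup G} (h : A ≤ B) (c : G) : A.conjBy c ≤ B.conjBy c :=
  map_mono h

theorem conjBy_inv_eq {A B : Subgroup G} {c : G} (h : A.conjBy c = B) : B.conjBy c⁻¹ = A := by
  rw [← h, conjBy_conjBy_s9, mul_inv_cancel, conjBy_one_s9]

/-- In a group without expanding inner automorphisms, finitely generated subgroups that are
conjugate into each other are conjugate. -/
theorem conjBy_eq_of_conjBy_le_of_conjBy_le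
    (hne : ∀ (f : G) (H : Subgroup G), H.FG → ¬ H < H.conjBy f)
    {A B : Subgroup G} (hB : B.FG) {a b : G} (ha : B.conjBy a ≤ A) (hb : A.conjBy b ≤ B) :
    A.conjBy b = B := by
  have hle : B.conjBy (a * b) ≤ A.conjBy b := conjBy_conjBy_s9 B a b ▸ conjBy_mono_s9 ha b
  have hexp : B ≤ B.conjBy (a * b)⁻¹ := by
    have h := conjBy_mono_s9 (hle.trans hb) (a * b)⁻¹
    rwa [conjBy_conjBy_s9, mul_inv_cancel, conjBy_one_s9] at h
  have heq : B.conjBy (a * b)⁻¹ = B := (hexp.eq_of_not_lt (hne _ B hB)).symm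
  have heq' : B.conjBy (a * b) = B := by
    simpa only [inv_inv] using conjBy_inv_eq heq
  exact hb.antisymm (heq' ▸ hle)

end Subgroup

/-- If a group `G` admits no expanding inner automorphisms and is SICS,
then it is SCS. -/
theorem scs_of_sics_of_no_expanding_inner {G : Type*} [Group G]
    (hne : ∀ (f : G) (H : Subgroup G), H.FG → ¬ H < H.conjBy f)
    (hsics : SICS G) : SCS G := by
  intro H₁ H₂ h₁ h₂ hconj
  by_cases h₂₁ : ∃ a : G, H₂.conjBy a ≤ H₁
  · have h₁₂ : ¬ ∃ b : G, H₁.conjBy b ≤ H₂ := by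
      rintro ⟨b, hb⟩
      obtain ⟨a, ha⟩ := h₂₁
      exact hconj ⟨b, Subgroup.conjBy_eq_of_conjBy_le_of_conjBy_le hne h₂ ha hb⟩
    obtain ⟨Q, hQ, hfin, φ, hφ, hsep⟩ := hsics H₂ H₁ h₂ h₁ h₁₂
    exact ⟨Q, hQ, hfin, φ, hφ, fun ⟨q, hq⟩ => hsep ⟨q, hq.le⟩⟩
  · obtain ⟨Q, hQ, hfin, φ, hφ, hsep⟩ := hsics H₁ H₂ h₁ h₂ h₂₁
    exact ⟨Q, hQ, hfin, φ, hφ, fun ⟨q, hq⟩ => hsep ⟨q⁻¹, (Subgroup.conjBy_inv_eq hq).le⟩⟩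
end

section
/- If a finitely generated free group F is subgroup into conjugacy separable (SICS), then F is subgroup conjugacy separable (SCS). -/
/-- An action of a free group can be approximated at a point by actions on finite sets:
for finitely many words `W` there is a finite subset `T` of the space acted on and an action of the
free group on `T` for which every `w ∈ W` moves the base point as in the original action. -/
theorem FreeGroup.exists_finite_action_s10 {X α : Type*} [MulAction (FreeGroup X) α]
    {W : Set (FreeGroup X)} (hW : W.Finite) (p : α) :
    ∃ (T : Finset α) (φ : FreeGroup X →* Equiv.Perm T) (t : T), (t : α) = p ∧
      ∀ w ∈ W, (φ w t : α) = w • p := by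
  classical
  let T : Finset α := insert p <|
    hW.toFinset.biUnion fun w => (w.toWord.tails.map fun l => FreeGroup.mk l • p).toFinset
  have hT : ∀ w ∈ W, ∀ l, l <:+ w.toWord → FreeGroup.mk l • p ∈ T := by
    intro w hw l hl
    refine Finset.mem_insert_of_mem (Finset.mem_biUnion.2 ⟨w, hW.mem_toFinset.2 hw, ?_⟩)
    simp only [List.mem_toFinset, List.mem_map, List.mem_tails]
    exact ⟨l, hl, rfl⟩
  have hperm : ∀ a : X, ∃ e : Equiv.Perm T,
      ∀ i : T, FreeGroup.of a • (i : α) ∈ T → (e i : α) = FreeGroup.of a • (i : α) := by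
    intro a
    exact Set.MapsTo.exists_equiv_extend_of_card_eq (α := T) (t := T) (Fintype.card_coe T)
      (s := {i : T | FreeGroup.of a • (i : α) ∈ T}) (f := fun i : T => FreeGroup.of a • (i : α))
      (fun i hi => hi) (fun i _ j _ hij => Subtype.ext (MulAction.injective _ hij))
  choose e he using hperm
  have he' : ∀ (a : X) (i : T), (FreeGroup.of a)⁻¹ • (i : α) ∈ T →
      ((e a)⁻¹ i : α) = (FreeGroup.of a)⁻¹ • (i : α) := by
    intro a i hi
    have h1 : e a ⟨_, hi⟩ = i := Subtype.ext (by rw [he a ⟨_, hi⟩ (by simp)]; simp)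
    rw [Equiv.Perm.inv_eq_iff_eq.2 h1.symm]
  let t : T := ⟨p, Finset.mem_insert_self _ _⟩
  have key : ∀ l : List (X × Bool), (∀ l', l' <:+ l → FreeGroup.mk l' • p ∈ T) →
      (FreeGroup.lift e (FreeGroup.mk l) t : α) = FreeGroup.mk l • p := by
    intro l
    induction l with
    | nil => intro _; simp [t, ← FreeGroup.one_eq_mk]
    | cons x l ih =>
      intro hl
      have ih := ih fun l' h' => hl l' (h'.trans (List.suffix_cons x l))
      have hx := hl _ (List.suffix_refl _)
      have hcons : FreeGroup.mk (x :: l) = FreeGroup.mk [x] * FreeGroup.mk l := by simp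
      rw [hcons, mul_smul] at hx ⊢
      rw [_root_.map_mul, Equiv.Perm.mul_apply]
      rw [← ih] at hx ⊢
      obtain ⟨a, b⟩ := x
      cases b with
      | true =>
        have hb : FreeGroup.mk [(a, true)] = FreeGroup.of a := rfl
        rw [hb] at hx ⊢
        rw [FreeGroup.lift_apply_of, he a _ hx]
      | false =>
        have hb : FreeGroup.mk [(a, false)] = (FreeGroup.of a)⁻¹ := rfl
        rw [hb] at hx ⊢
        rw [_root_.map_inv, FreeGroup.lift_apply_of, he' a _ hx]
  refine ⟨T, FreeGroup.lift e, t, rfl, fun w hw => ?_⟩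
  have := key w.toWord (hT w hw)
  rwa [FreeGroup.mk_toWord] at this

universe u in
/-- **Marshall Hall's theorem**: finitely generated subgroups of free groups are separable. -/
theorem FreeGroup.exists_finite_quotient_notMem_map {X : Type u} {H : Subgroup (FreeGroup X)}
    (hH : H.FG) {x : FreeGroup X} (hx : x ∉ H) :
    ∃ (Q : Type u) (_ : Group Q) (_ : Finite Q) (φ : FreeGroup X →* Q), φ x ∉ H.map φ := by
  classical
  obtain ⟨S, hS⟩ := hH
  obtain ⟨T, φ, t, ht, hφ⟩ := FreeGroup.exists_finite_action_s10
    ((S.finite_toSet).insert x) (QuotientGroup.mk 1 : FreeGroup X ⧸ H)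
  refine ⟨Equiv.Perm T, inferInstance, inferInstance, φ, fun hmem => hx ?_⟩
  have hle : H.map φ ≤ MulAction.stabilizer (Equiv.Perm T) t := by
    rw [Subgroup.map_le_iff_le_comap]
    refine hS.ge.trans ((Subgroup.closure_le _).2 ?_)
    intro w hw
    have hwH : w ∈ H := hS ▸ Subgroup.subset_closure hw
    refine MulAction.mem_stabilizer_iff.2 (Subtype.ext ?_)
    rw [Equiv.Perm.smul_def, hφ w (Set.mem_insert_of_mem _ hw), ht, MulAction.Quotient.smul_mk]
    exact QuotientGroup.eq.2 (by simpa using hwH)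
  have h1 : φ x t = t := MulAction.mem_stabilizer_iff.1 (hle hmem)
  have h2 := hφ x (Set.mem_insert _ _)
  rw [h1, ht, MulAction.Quotient.smul_mk] at h2
  simpa using QuotientGroup.eq.1 h2

theorem Subgroup.conjBy_mul {G : Type*} [Group G] (A : Subgroup G) (c d : G) :
    A.conjBy (c * d) = (A.conjBy c).conjBy d := by
  simp only [Subgroup.conjBy, Subgroup.map_map]
  congr 1
  ext
  simp [mul_assoc]

theorem Subgroup.conjBy_inv_eq_s10 {G : Type*} [Group G] {A B : Subgroup G} {c : G}
    (h : A.conjBy c = B) : B.conjBy c⁻¹ = A := by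
  rw [← h, ← Subgroup.conjBy_mul, mul_inv_cancel]
  ext
  simp [Subgroup.conjBy]

theorem Subgroup.map_conjBy {G Q : Type*} [Group G] [Group Q] (A : Subgroup G) (c : G)
    (φ : G →* Q) : (A.conjBy c).map φ = (A.map φ).conjBy (φ c) := by
  simp only [Subgroup.conjBy, Subgroup.map_map]
  congr 1
  ext
  simp

theorem Subgroup.card_conjBy {G : Type*} [Group G] (A : Subgroup G) (c : G) :
    Nat.card (A.conjBy c) = Nat.card A :=
  Nat.card_congr (A.equivMapOfInjective _ (MulAut.conj c⁻¹).injective).symm.toEquiv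

/-- A finitely generated subgroup of a free group contains no proper conjugate of itself. -/
theorem FreeGroup.conjBy_eq_of_le {X : Type*} {H : Subgroup (FreeGroup X)} (hH : H.FG)
    {g : FreeGroup X} (hg : H.conjBy g ≤ H) : H.conjBy g = H := by
  refine le_antisymm hg fun x hx => by_contra fun hxg => ?_
  have hfg : (H.conjBy g).FG := (Subgroup.fg_iff_submonoid_fg _).2
    (((Subgroup.fg_iff_submonoid_fg H).1 hH).map (MulAut.conj g⁻¹).toMonoidHom)
  obtain ⟨Q, _, _, φ, hφ⟩ := FreeGroup.exists_finite_quotient_notMem_map hfg hxg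
  have heq : (H.conjBy g).map φ = H.map φ := by
    refine Subgroup.eq_of_le_of_card_ge (Subgroup.map_mono hg) ?_
    rw [Subgroup.map_conjBy, Subgroup.card_conjBy]
  exact hφ (heq ▸ Subgroup.mem_map_of_mem φ hx)

/-- If a finitely generated free group is SICS, then it is SCS. -/
theorem freeGroup_scs_of_sics (X : Type*) [Finite X]
    (h : SICS (FreeGroup X)) : SCS (FreeGroup X) := by
  intro H₁ H₂ h₁ h₂ hne
  by_cases h21 : ∃ c, H₂.conjBy c ≤ H₁
  · by_cases h12 : ∃ c, H₁.conjBy c ≤ H₂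
    · obtain ⟨c, hc⟩ := h21
      obtain ⟨d, hd⟩ := h12
      have hdc : (H₁.conjBy d).conjBy c ≤ H₂.conjBy c := Subgroup.map_mono hd
      rw [← Subgroup.conjBy_mul] at hdc
      rw [FreeGroup.conjBy_eq_of_le h₁ (hdc.trans hc)] at hdc
      exact (hne ⟨c⁻¹, Subgroup.conjBy_inv_eq_s10 (le_antisymm hc hdc)⟩).elim
    · obtain ⟨Q, i, j, φ, hφ, hn⟩ := h H₂ H₁ h₂ h₁ h12
      exact ⟨Q, i, j, φ, hφ, fun ⟨q, hq⟩ => hn ⟨q, hq.le⟩⟩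
  · obtain ⟨Q, i, j, φ, hφ, hn⟩ := h H₁ H₂ h₁ h₂ h21
    exact ⟨Q, i, j, φ, hφ, fun ⟨q, hq⟩ => hn ⟨q⁻¹, (Subgroup.conjBy_inv_eq_s10 hq).le⟩⟩
end

section
/- Let F be a free group of finite rank and let H₁, H₂ be finitely generated subgroups of F such that H₂ is not conjugate into H₁. Then there exists a finite-index subgroup D of F containing H₁ such that H₂ is not conjugate into D. In other words, every finitely generated subgroup of a finitely generated free group is con-separated. -/
namespace FreeGroup

variable {X : Type*}

section WordBall

open Classical in
/-- The ball of radius `n` about `1` in the word metric. -/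
def wordBall (X : Type*) (n : ℕ) : Set (FreeGroup X) := {f | f.norm ≤ n}

theorem wordBall_mono {m n : ℕ} (h : m ≤ n) : wordBall X m ⊆ wordBall X n :=
  fun _ hf => le_trans hf h

theorem one_mem_wordBall (n : ℕ) : (1 : FreeGroup X) ∈ wordBall X n := by
  simp [wordBall]

theorem inv_mem_wordBall {n : ℕ} {f : FreeGroup X} (hf : f ∈ wordBall X n) :
    f⁻¹ ∈ wordBall X n := by
  classical simpa [wordBall] using hf

theorem mul_mem_wordBall {m n : ℕ} {f g : FreeGroup X} (hf : f ∈ wordBall X m)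
    (hg : g ∈ wordBall X n) : f * g ∈ wordBall X (m + n) := by
  classical exact (norm_mul_le f g).trans (add_le_add hf hg)

theorem of_mem_wordBall (b : X) : of b ∈ wordBall X 1 := by
  simp [wordBall]

theorem mk_mem_wordBall {n : ℕ} {w : List (X × Bool)} (hw : w.length ≤ n) :
    mk w ∈ wordBall X n := by
  classical exact norm_mk_le.trans hw

theorem exists_mk_of_mem_wordBall {n : ℕ} {f : FreeGroup X} (hf : f ∈ wordBall X n) :
    ∃ w : List (X × Bool), w.length ≤ n ∧ mk w = f := by
  classical exact ⟨f.toWord, by simpa [wordBall, norm] using hf, mk_toWord⟩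

theorem finite_wordBall [Finite X] (n : ℕ) : (wordBall X n).Finite := by
  refine ((List.finite_length_le (X × Bool) n).image mk).subset fun f hf => ?_
  obtain ⟨w, hw, rfl⟩ := exists_mk_of_mem_wordBall hf
  exact ⟨w, hw, rfl⟩

theorem exists_subset_wordBall {S : Set (FreeGroup X)} (hS : S.Finite) :
    ∃ n, S ⊆ wordBall X n := by
  classical
  obtain ⟨n, hn⟩ := (hS.image norm).bddAbove
  refine ⟨n, fun f hf => ?_⟩
  simpa [wordBall] using hn ⟨f, hf, rfl⟩

end WordBall

/-- A map that commutes with the generators inside a set `T` commutes with every word whose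
trajectory stays in `T`. -/
theorem map_mk_of_forall_suffix {A B : Type*} (α : FreeGroup X →* Equiv.Perm A)
    (β : FreeGroup X →* Equiv.Perm B) (φ : A → B) (T : Set A)
    (hT : ∀ b z, z ∈ T → α (of b) z ∈ T → φ (α (of b) z) = β (of b) (φ z))
    (w : List (X × Bool)) (x : A) (hw : ∀ u, u <:+ w → α (mk u) x ∈ T) :
    φ (α (mk w) x) = β (mk w) (φ x) := by
  induction w with
  | nil => simp [← one_eq_mk]
  | cons l w ih =>
    have ih := ih fun u hu => hw u (hu.trans (List.suffix_cons l w))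
    have h1 := hw w (List.suffix_cons l w)
    have h2 := hw _ List.suffix_rfl
    obtain ⟨b, _ | _⟩ := l
    · have e : mk ((b, false) :: w) = (of b)⁻¹ * mk w := rfl
      rw [e] at h2 ⊢
      have h3 := hT b _ h2 (by simpa using h1)
      rw [← Equiv.Perm.mul_apply, ← _root_.map_mul, mul_inv_cancel_left, ih] at h3
      rw [_root_.map_mul β, Equiv.Perm.mul_apply, h3, _root_.map_inv, Equiv.Perm.inv_def,
        Equiv.symm_apply_apply]
    · have e : mk ((b, true) :: w) = of b * mk w := rfl
      rw [e] at h2 ⊢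
      simp only [_root_.map_mul, Equiv.Perm.mul_apply] at h2 ⊢
      rw [← ih, hT b _ h1 h2]

/-- The partial action of the generators on a finite subset extends to permutations. -/
theorem exists_perm_extending_s18 {Ω : Type*} [MulAction (FreeGroup X) Ω] {V : Set Ω}
    (hV : V.Finite) :
    ∃ σ : X → Equiv.Perm V, ∀ b (v : V), of b • (v : Ω) ∈ V → (σ b v : Ω) = of b • (v : Ω) := by
  classical
  have : Finite V := hV
  let e (b : X) : {v : V // of b • (v : Ω) ∈ V} ≃ {v : V // (of b)⁻¹ • (v : Ω) ∈ V} :=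
    { toFun := fun v => ⟨⟨_, v.2⟩, by simp⟩
      invFun := fun v => ⟨⟨_, v.2⟩, by simp⟩
      left_inv := fun v => by simp
      right_inv := fun v => by simp }
  have : Fintype V := Fintype.ofFinite V
  refine ⟨fun b => (e b).extendSubtype, fun b v hv => ?_⟩
  rw [Equiv.extendSubtype_apply_of_mem _ v hv]
  rfl

/-- Some homomorphism from a free group of finite rank to a finite group is injective on a given
ball. -/
theorem exists_finite_injOn_wordBall.{u} {X : Type u} [Finite X] (n : ℕ) :
    ∃ (Q : Type u) (_ : Group Q) (_ : Finite Q) (ρ : FreeGroup X →* Q),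
      Set.InjOn ρ (wordBall X n) := by
  classical
  have hV := finite_wordBall (X := X) n
  have : Finite (wordBall X n) := hV
  obtain ⟨σ, hσ⟩ := exists_perm_extending_s18 (X := X) hV
  refine ⟨Equiv.Perm (wordBall X n), inferInstance, inferInstance, lift σ, ?_⟩
  let v₁ : wordBall X n := ⟨1, one_mem_wordBall n⟩
  let φ : FreeGroup X → wordBall X n := fun f => if h : f ∈ wordBall X n then ⟨f, h⟩ else v₁
  have key : ∀ f ∈ wordBall X n, (lift σ f v₁ : FreeGroup X) = f := by
    intro f hf
    obtain ⟨w, hw, rfl⟩ := exists_mk_of_mem_wordBall hf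
    have := map_mk_of_forall_suffix (MulAction.toPermHom (FreeGroup X) (FreeGroup X)) (lift σ) φ
      (wordBall X n) (fun b z hz hbz => ?_) w 1
      (fun u hu => by simpa using mk_mem_wordBall (hu.length_le.trans hw))
    · have h1 : φ 1 = v₁ := by simp [φ, v₁]
      rw [h1] at this
      rw [← this]
      simp [φ, hf]
    · simp only [MulAction.toPermHom_apply, MulAction.toPerm_apply] at hbz ⊢
      apply Subtype.ext
      simp only [φ, hz, hbz, dif_pos, lift_apply_of]
      rw [hσ b ⟨z, hz⟩ hbz]
  intro f hf g hg h
  rw [← key f hf, ← key g hg, h]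

section Graft

variable {V Q : Type*} [Group Q]

open Classical in
/-- For each `v ∈ A b`, the transposition of `v` with the identity of the copy of `Q` indexed by
`(b, v)`. -/
noncomputable def graftSwap (Q : Type*) [Group Q] (A : X → Set V) (b : X) :
    Equiv.Perm (V ⊕ (X × V) × Q) :=
  Function.Involutive.toPerm
    (Sum.elim (fun v => if v ∈ A b then Sum.inr ((b, v), 1) else Sum.inl v)
      (fun y => if y.1.1 = b ∧ y.2 = 1 ∧ y.1.2 ∈ A b then Sum.inl y.1.2 else Sum.inr y))
    (by
      rintro (v | ⟨⟨a, v⟩, q⟩)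
      · by_cases h : v ∈ A b <;> simp [h]
      · by_cases h : a = b ∧ q = 1 ∧ v ∈ A b
        · obtain ⟨rfl, rfl, h⟩ := h
          simp [h]
        · simp [h])

open Classical in
theorem graftSwap_inl (A : X → Set V) (b : X) (v : V) :
    graftSwap Q A b (Sum.inl v) = if v ∈ A b then Sum.inr ((b, v), 1) else Sum.inl v :=
  rfl

open Classical in
theorem graftSwap_inr (A : X → Set V) (a b : X) (v : V) (q : Q) :
    graftSwap Q A b (Sum.inr ((a, v), q)) =
      if a = b ∧ q = 1 ∧ v ∈ A b then Sum.inl v else Sum.inr ((a, v), q) :=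
  rfl

/-- The action of a free group on `V ⊕ (X × V) × Q` in which the `b`-edge leaving `v`, for
`v ∈ A b`, is subdivided by a copy of the Cayley graph of `Q` cut open along the `b`-edge
leaving `1`. -/
noncomputable def graft (A : X → Set V) (σ : X → Equiv.Perm V) (ρ : FreeGroup X →* Q) :
    FreeGroup X →* Equiv.Perm (V ⊕ (X × V) × Q) :=
  lift fun b =>
    Equiv.sumCongr (σ b) (Equiv.prodCongr (Equiv.refl _) (Equiv.mulLeft (ρ (of b)))) *
      graftSwap Q A b

variable {A : X → Set V} {σ : X → Equiv.Perm V} {ρ : FreeGroup X →* Q}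

theorem graft_of_inl_of_mem {b : X} {v : V} (h : v ∈ A b) :
    graft A σ ρ (of b) (Sum.inl v) = Sum.inr ((b, v), ρ (of b)) := by
  simp [graft, graftSwap_inl, h]

theorem graft_of_inl_of_notMem {b : X} {v : V} (h : v ∉ A b) :
    graft A σ ρ (of b) (Sum.inl v) = Sum.inl (σ b v) := by
  simp [graft, graftSwap_inl, h]

theorem graft_of_inr_one {b : X} {v : V} (h : v ∈ A b) :
    graft A σ ρ (of b) (Sum.inr ((b, v), 1)) = Sum.inl (σ b v) := by
  simp [graft, graftSwap_inr, h]

theorem graft_of_inr {a b : X} {v : V} {q : Q} (h : ¬(a = b ∧ q = 1 ∧ v ∈ A b)) :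
    graft A σ ρ (of b) (Sum.inr ((a, v), q)) = Sum.inr ((a, v), ρ (of b) * q) := by
  simp [graft, graftSwap_inr, h]

/-- The map from the graft of copies of the free group to the graft of copies of `Q`. -/
def graftMap (V : Type*) (ρ : FreeGroup X →* Q) :
    V ⊕ (X × V) × FreeGroup X → V ⊕ (X × V) × Q :=
  Sum.map id (Prod.map id ρ)

/-- The ball of radius `n` about `V` in the graft of copies of the free group. -/
def graftBall (X V : Type*) (n : ℕ) : Set (V ⊕ (X × V) × FreeGroup X) :=
  {x | ∀ y, x = Sum.inr y → y.2 ∈ wordBall X n}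

theorem graftBall_mono {m n : ℕ} (h : m ≤ n) : graftBall X V m ⊆ graftBall X V n :=
  fun _ hx y hy => wordBall_mono h (hx y hy)

@[simp]
theorem inl_mem_graftBall (n : ℕ) (v : V) : Sum.inl v ∈ graftBall X V n := by
  simp [graftBall]

@[simp]
theorem inr_mem_graftBall {n : ℕ} {y : (X × V) × FreeGroup X} :
    Sum.inr y ∈ graftBall X V n ↔ y.2 ∈ wordBall X n :=
  ⟨fun h => h y rfl, fun h _ hy => Sum.inr_injective hy ▸ h⟩

theorem injOn_graftMap {n : ℕ} (hρ : Set.InjOn ρ (wordBall X n)) :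
    Set.InjOn (graftMap V ρ) (graftBall X V n) := by
  rintro (v | ⟨e, f⟩) hx (v' | ⟨e', f'⟩) hy h
  · simpa [graftMap] using h
  · simp [graftMap] at h
  · simp [graftMap] at h
  · simp only [graftMap, Sum.map_inr, Prod.map_apply, id_eq, Sum.inr.injEq, Prod.mk.injEq] at h
    rw [h.1, hρ (by simpa using hx) (by simpa using hy) h.2]

theorem graftMap_graft_of {n : ℕ} (hρ : Set.InjOn ρ (wordBall X n)) (b : X)
    {x : V ⊕ (X × V) × FreeGroup X} (hx : x ∈ graftBall X V n) :
    graftMap V ρ (graft A σ (MonoidHom.id _) (of b) x) =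
      graft A σ ρ (of b) (graftMap V ρ x) := by
  obtain v | ⟨⟨a, v⟩, f⟩ := x
  · by_cases h : v ∈ A b
    · simp [graftMap, graft_of_inl_of_mem h]
    · simp [graftMap, graft_of_inl_of_notMem h]
  · by_cases h : a = b ∧ f = 1 ∧ v ∈ A b
    · obtain ⟨rfl, rfl, h⟩ := h
      simp [graftMap, graft_of_inr_one h]
    · have h' : ¬(a = b ∧ ρ f = 1 ∧ v ∈ A b) := fun h' => h ⟨h'.1,
        hρ (by simpa using hx) (one_mem_wordBall n) (by simpa using h'.2.1), h'.2.2⟩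
      simp [graftMap, graft_of_inr h, graft_of_inr h']

theorem graftSwap_mem_graftBall {n : ℕ} (b : X) {x : V ⊕ (X × V) × FreeGroup X}
    (hx : x ∈ graftBall X V n) : graftSwap (FreeGroup X) A b x ∈ graftBall X V n := by
  obtain v | ⟨⟨a, v⟩, f⟩ := x
  · by_cases h : v ∈ A b <;> simp [graftSwap_inl, h, one_mem_wordBall]
  · by_cases h : a = b ∧ f = 1 ∧ v ∈ A b
    · simp [graftSwap_inr, h]
    · simpa [graftSwap_inr, h] using hx

theorem graft_mk_mem_graftBall {n : ℕ} (w : List (X × Bool)) {x : V ⊕ (X × V) × FreeGroup X}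
    (hx : x ∈ graftBall X V n) :
    graft A σ (MonoidHom.id _) (mk w) x ∈ graftBall X V (w.length + n) := by
  induction w with
  | nil => simpa [← one_eq_mk] using hx
  | cons l w ih =>
    set y := graft A σ (MonoidHom.id _) (mk w) x with hy
    rw [List.length_cons, show w.length + 1 + n = 1 + (w.length + n) by ring]
    obtain ⟨b, _ | _⟩ := l
    · have e : mk ((b, false) :: w) = (of b)⁻¹ * mk w := rfl
      rw [e, _root_.map_mul, Equiv.Perm.mul_apply, ← hy, _root_.map_inv, graft, lift_apply_of,
        mul_inv_rev, Equiv.Perm.mul_apply]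
      have hinv : (graftSwap (FreeGroup X) A b)⁻¹ = graftSwap (FreeGroup X) A b := rfl
      rw [hinv]
      apply graftSwap_mem_graftBall
      obtain v | ⟨e, f⟩ := y
      · exact inl_mem_graftBall _ _
      · have := mul_mem_wordBall (inv_mem_wordBall (of_mem_wordBall b))
          (inr_mem_graftBall.1 ih)
        simpa [Equiv.Perm.inv_def] using this
    · have e : mk ((b, true) :: w) = of b * mk w := rfl
      rw [e, _root_.map_mul, Equiv.Perm.mul_apply, ← hy, graft, lift_apply_of,
        Equiv.Perm.mul_apply]
      have := graftSwap_mem_graftBall (A := A) b ih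
      generalize graftSwap (FreeGroup X) A b y = z at this ⊢
      obtain v | ⟨e, f⟩ := z
      · exact inl_mem_graftBall _ _
      · simpa using mul_mem_wordBall (of_mem_wordBall b) (inr_mem_graftBall.1 this)

theorem graftMap_graft_mk {m n k : ℕ} (hρ : Set.InjOn ρ (wordBall X n)) (hmk : k + m ≤ n)
    {w : List (X × Bool)} (hw : w.length ≤ k) {x : V ⊕ (X × V) × FreeGroup X}
    (hx : x ∈ graftBall X V m) :
    graftMap V ρ (graft A σ (MonoidHom.id _) (mk w) x) =
      graft A σ ρ (mk w) (graftMap V ρ x) :=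
  map_mk_of_forall_suffix _ _ _ (graftBall X V n)
    (fun b _ hz _ => graftMap_graft_of hρ b hz) w x fun u hu =>
      graftBall_mono (by have := hu.length_le; lia) (graft_mk_mem_graftBall u hx)

/-- Far from `V`, short words act on the graft by translation in a copy of `Q`. -/
theorem graft_mk_inr_of_notMem {k : ℕ} {w : List (X × Bool)} (hw : w.length ≤ k) (e : X × V)
    {q : Q} (hq : q ∉ ρ '' wordBall X k) :
    graft A σ ρ (mk w) (Sum.inr (e, q)) = Sum.inr (e, ρ (mk w) * q) := by
  have := map_mk_of_forall_suffix ((MulAction.toPermHom Q Q).comp ρ) (graft A σ ρ)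
    (fun q => Sum.inr (e, q)) {1}ᶜ (fun b z hz _ => ?_) w q fun u hu h => ?_
  · simpa using this.symm
  · rw [graft_of_inr fun h => hz h.2.1]
    simp
  · refine hq ⟨(mk u)⁻¹, inv_mem_wordBall (mk_mem_wordBall (hu.length_le.trans hw)), ?_⟩
    rw [_root_.map_inv]
    exact inv_eq_of_mul_eq_one_right (by simpa using h)

/-- If `ρ` is injective on a large ball, then a set of short words fixing a point of the finite
graft either is trivial or fixes a point of the infinite one. -/
theorem eq_one_or_exists_fixed_of_graft_fixed {k : ℕ} (hρ : Set.InjOn ρ (wordBall X (k + k)))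
    {S : Set (FreeGroup X)} (hS : S ⊆ wordBall X k) {y : V ⊕ (X × V) × Q}
    (hy : ∀ s ∈ S, graft A σ ρ s y = y) :
    (∀ s ∈ S, s = 1) ∨ ∃ x, ∀ s ∈ S, graft A σ (MonoidHom.id _) s x = x := by
  by_cases h : ∃ x ∈ graftBall X V k, graftMap V ρ x = y
  · obtain ⟨x, hx, rfl⟩ := h
    refine Or.inr ⟨x, fun s hs => ?_⟩
    obtain ⟨w, hw, rfl⟩ := exists_mk_of_mem_wordBall (hS hs)
    exact injOn_graftMap hρ (graftBall_mono (by lia) (graft_mk_mem_graftBall w hx))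
      (graftBall_mono (by lia) hx) ((graftMap_graft_mk hρ le_rfl hw hx).trans (hy _ hs))
  · refine Or.inl fun s hs => ?_
    obtain v | ⟨e, q⟩ := y
    · exact absurd ⟨Sum.inl v, inl_mem_graftBall _ _, rfl⟩ h
    have hq : q ∉ ρ '' wordBall X k := by
      rintro ⟨f, hf, rfl⟩
      exact h ⟨Sum.inr (e, f), inr_mem_graftBall.2 hf, rfl⟩
    have hs' := hy s hs
    obtain ⟨w, hw, rfl⟩ := exists_mk_of_mem_wordBall (hS hs)
    rw [graft_mk_inr_of_notMem hw e hq] at hs'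
    exact hρ (wordBall_mono (by lia) (hS hs)) (one_mem_wordBall _) (by simpa using hs')

end Graft

section Development

open Classical in
/-- The reduced word of the element ends with the letter `a`. -/
def EndsWith (a : X) (f : FreeGroup X) : Prop := f.toWord.getLast? = some (a, true)

theorem not_endsWith_one (a : X) : ¬EndsWith a 1 := by simp [EndsWith]

theorem endsWith_of {a b : X} : EndsWith a (of b) ↔ b = a := by simp [EndsWith]

theorem endsWith_of_mul {a b : X} {f : FreeGroup X} (hf : f ≠ 1) :
    EndsWith a (of b * f) ↔ EndsWith a f := by
  classical
  have e : (of b * f).toWord = reduce ((b, true) :: f.toWord) := by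
    rw [toWord_mul, toWord_of, List.singleton_append]
  have hf' : f.toWord ≠ [] := by simpa using hf
  have hr : reduce f.toWord = f.toWord := reduce_toWord f
  unfold EndsWith
  rw [e, reduce.cons, hr]
  rcases hw : f.toWord with _ | ⟨⟨c, d⟩, w⟩
  · exact absurd hw hf'
  · by_cases h : b = c ∧ d = false
    · obtain ⟨rfl, rfl⟩ := h
      cases w <;> simp
    · simp [h]

variable {Ω : Type*} [MulAction (FreeGroup X) Ω] {V : Set Ω}

open Classical in
/-- The map from the infinite graft of a finite part `V` of `Ω` back to `Ω`. -/
noncomputable def develop (σ : X → Equiv.Perm V) : V ⊕ (X × V) × FreeGroup X → Ω :=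
  Sum.elim Subtype.val fun y =>
    if EndsWith y.1.1 y.2 then y.2 • (y.1.2 : Ω)
    else y.2 • (of y.1.1)⁻¹ • (σ y.1.1 y.1.2 : Ω)

theorem develop_graft_of {σ : X → Equiv.Perm V}
    (hσ : ∀ b (v : V), of b • (v : Ω) ∈ V → (σ b v : Ω) = of b • (v : Ω)) (b : X)
    (x : V ⊕ (X × V) × FreeGroup X) :
    develop σ (graft (fun b => {v : V | of b • (v : Ω) ∉ V}) σ (MonoidHom.id _) (of b) x) =
      of b • develop σ x := by
  obtain v | ⟨⟨a, v⟩, f⟩ := x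
  · by_cases h : of b • (v : Ω) ∈ V
    · rw [graft_of_inl_of_notMem (by simpa using h)]
      simp [develop, hσ b v h]
    · rw [graft_of_inl_of_mem (by simpa using h)]
      simp [develop, endsWith_of]
  · by_cases h : a = b ∧ f = 1 ∧ of b • (v : Ω) ∉ V
    · obtain ⟨rfl, rfl, h⟩ := h
      rw [graft_of_inr_one (by simpa using h)]
      simp [develop, not_endsWith_one]
    · rw [graft_of_inr (by simpa using h)]
      by_cases hf : f = 1
      · subst hf
        by_cases hab : a = b
        · subst hab
          have hv : of a • (v : Ω) ∈ V := by simpa using h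
          simp [develop, not_endsWith_one, endsWith_of, hσ a v hv]
        · simp [develop, not_endsWith_one, endsWith_of, Ne.symm hab]
      · by_cases hs : EndsWith a f <;> simp [develop, endsWith_of_mul hf, hs, mul_smul]

theorem develop_graft {σ : X → Equiv.Perm V}
    (hσ : ∀ b (v : V), of b • (v : Ω) ∈ V → (σ b v : Ω) = of b • (v : Ω)) (f : FreeGroup X)
    (x : V ⊕ (X × V) × FreeGroup X) :
    develop σ (graft (fun b => {v : V | of b • (v : Ω) ∉ V}) σ (MonoidHom.id _) f x) =
      f • develop σ x := by
  classical
  have := map_mk_of_forall_suffix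
    (graft (fun b => {v : V | of b • (v : Ω) ∉ V}) σ (MonoidHom.id _))
    (MulAction.toPermHom (FreeGroup X) Ω) (develop σ) Set.univ
    (fun b z _ _ => develop_graft_of hσ b z) f.toWord x fun _ _ => Set.mem_univ _
  simpa [mk_toWord] using this

/-- Words whose trajectory stays in `V` act on the graft as they do on `Ω`. -/
theorem graft_mk_inl {Q : Type*} [Group Q] {ρ : FreeGroup X →* Q} {σ : X → Equiv.Perm V}
    (hσ : ∀ b (v : V), of b • (v : Ω) ∈ V → (σ b v : Ω) = of b • (v : Ω))
    {w : List (X × Bool)} {p : V} (hw : ∀ u, u <:+ w → mk u • (p : Ω) ∈ V) :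
    graft (fun b => {v : V | of b • (v : Ω) ∉ V}) σ ρ (mk w) (Sum.inl p) =
      Sum.inl ⟨mk w • (p : Ω), hw w List.suffix_rfl⟩ := by
  classical
  have := map_mk_of_forall_suffix (MulAction.toPermHom (FreeGroup X) Ω)
    (graft (fun b => {v : V | of b • (v : Ω) ∉ V}) σ ρ)
    (fun z => Sum.inl (if h : z ∈ V then ⟨z, h⟩ else p)) V (fun b z hz hbz => ?_) w p
    (by simpa using hw)
  · have hp := hw w List.suffix_rfl
    simpa [hp] using this.symm
  · simp only [MulAction.toPermHom_apply, MulAction.toPerm_apply] at hbz ⊢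
    rw [graft_of_inl_of_notMem (by simpa [hz] using hbz)]
    simp only [hz, hbz, dif_pos, Sum.inl.injEq]
    exact Subtype.ext (hσ b ⟨z, hz⟩ hbz).symm

end Development

end FreeGroup


/-- Every finitely generated subgroup `H₁` of a free group of finite rank is
con-separated: for every finitely generated subgroup `H₂` not conjugate into
`H₁`, there is a finite-index subgroup `D` containing `H₁` such that `H₂` is
not conjugate into `D`. -/
theorem freeGroup_conSeparated (X : Type*) [Finite X]
    (H₁ : Subgroup (FreeGroup X)) (h1 : H₁.FG)
    (H₂ : Subgroup (FreeGroup X)) (h2 : H₂.FG)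
    (hnc : ¬ ∃ c : FreeGroup X, H₂.conjBy c ≤ H₁) :
    ∃ D : Subgroup (FreeGroup X), D.FiniteIndex ∧ H₁ ≤ D ∧
      ¬ ∃ c : FreeGroup X, H₂.conjBy c ≤ D := by
  obtain ⟨S₁, rfl, hS₁⟩ := (Subgroup.fg_iff H₁).1 h1
  obtain ⟨S₂, rfl, hS₂⟩ := (Subgroup.fg_iff H₂).1 h2
  set H₁ := Subgroup.closure S₁
  obtain ⟨m, hm⟩ := FreeGroup.exists_subset_wordBall hS₁
  obtain ⟨k, hk⟩ := FreeGroup.exists_subset_wordBall hS₂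
  let p₀ : FreeGroup X ⧸ H₁ := ((1 : FreeGroup X) : FreeGroup X ⧸ H₁)
  let V : Set (FreeGroup X ⧸ H₁) := (fun f : FreeGroup X => f • p₀) '' FreeGroup.wordBall X m
  have hV : V.Finite := (FreeGroup.finite_wordBall m).image _
  have : Finite V := hV
  obtain ⟨σ, hσ⟩ := FreeGroup.exists_perm_extending_s18 (X := X) hV
  obtain ⟨Q, _, _, ρ, hρ⟩ := FreeGroup.exists_finite_injOn_wordBall (X := X) (k + k)
  let p : V := ⟨p₀, 1, FreeGroup.one_mem_wordBall m, one_smul _ _⟩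
  let β := FreeGroup.graft (fun b => {v : V | FreeGroup.of b • (v : FreeGroup X ⧸ H₁) ∉ V}) σ ρ
  let D := (MulAction.stabilizer (Equiv.Perm (V ⊕ (X × V) × Q))
    (Sum.inl p : V ⊕ (X × V) × Q)).comap β
  have memD (f : FreeGroup X) : f ∈ D ↔ β f (Sum.inl p) = Sum.inl p := Iff.rfl
  refine ⟨D, ?_, ?_, ?_⟩
  · have hle : β.ker ≤ D := fun f hf => by
      rw [memD, MonoidHom.mem_ker.1 hf, Equiv.Perm.one_apply]
    exact Subgroup.finiteIndex_of_le hle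
  · refine (Subgroup.closure_le D).2 fun s hs => (memD s).2 ?_
    have hsp : s • p₀ = p₀ := by
      change ((s * 1 : FreeGroup X) : FreeGroup X ⧸ H₁) = ((1 : FreeGroup X) : FreeGroup X ⧸ H₁)
      rw [eq_comm, QuotientGroup.eq]
      simpa using Subgroup.subset_closure hs
    obtain ⟨w, hw, rfl⟩ := FreeGroup.exists_mk_of_mem_wordBall (hm hs)
    refine (FreeGroup.graft_mk_inl hσ fun u hu =>
      ⟨_, FreeGroup.mk_mem_wordBall (hu.length_le.trans hw), rfl⟩).trans ?_
    exact congrArg Sum.inl (Subtype.ext hsp)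
  · rintro ⟨c, hc⟩
    have hfix : ∀ s ∈ S₂, β s (β c (Sum.inl p)) = β c (Sum.inl p) := fun s hs => by
      have := (memD _).1 (hc ⟨s, Subgroup.subset_closure hs, rfl⟩)
      simpa [Equiv.symm_apply_eq] using this
    obtain h | ⟨x, hx⟩ := FreeGroup.eq_one_or_exists_fixed_of_graft_fixed hρ hk hfix
    · refine hnc ⟨1, ?_⟩
      have : Subgroup.closure S₂ = ⊥ := (Subgroup.closure_eq_bot_iff).2 h
      simp [this, Subgroup.conjBy]
    · obtain ⟨g, hg⟩ := QuotientGroup.mk_surjective (FreeGroup.develop σ x)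
      refine hnc ⟨g, Subgroup.map_le_iff_le_comap.2 ((Subgroup.closure_le _).2 fun s hs => ?_)⟩
      have h := FreeGroup.develop_graft hσ s x
      rw [hx s hs, ← hg] at h
      replace h : (g : FreeGroup X ⧸ H₁) = ((s * g : FreeGroup X) : FreeGroup X ⧸ H₁) := h
      rw [QuotientGroup.eq] at h
      simpa [mul_assoc] using h
end

section
/- Let G be a group whose derived series G = G⁽⁰⁾ ≥ G⁽¹⁾ ≥ G⁽²⁾ ≥ ⋯ has trivial intersection (⋂_{i} G⁽ⁱ⁾ = 1) and torsion-free abelian quotients G⁽ⁱ⁾/G⁽ⁱ⁺¹⁾ for all i. Let a₁, …, a_k be elements of G, and let H be a subgroup of G whose derived series H = H⁽⁰⁾ > H⁽¹⁾ > H⁽²⁾ > ⋯ is strictly descending at every step. Then there exists an element x ∈ H that is not conjugate in G to any power of any a_j, i.e., x is not of the form c⁻¹ a_j^ℓ c for any c ∈ G, any j ∈ {1, …, k}, and any integer ℓ. -/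
/-- If the quotients of successive terms of the derived series are torsion-free, then each term
is closed under taking roots. -/
theorem mem_derivedSeries_of_pow_mem {G : Type*} [Group G]
    (hTF : ∀ i : ℕ, ∀ x ∈ derivedSeries G i, ∀ n : ℕ, 0 < n →
      x ^ n ∈ derivedSeries G (i + 1) → x ∈ derivedSeries G (i + 1))
    {x : G} {m : ℕ} (hm : 0 < m) (n : ℕ) (hx : x ^ m ∈ derivedSeries G n) :
    x ∈ derivedSeries G n := by
  induction n with
  | zero => simp
  | succ n ih =>
    exact hTF n x (ih (derivedSeries_antitone G n.le_succ hx)) m hm hx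

/-- If the derived series has trivial intersection, then some term of it contains no nontrivial
member of a given finite family. -/
theorem exists_derivedSeries_eq_one_of_mem {G : Type*} [Group G]
    (hInt : ⨅ i : ℕ, derivedSeries G i = ⊥) {ι : Type*} [Fintype ι] (a : ι → G) :
    ∃ n : ℕ, ∀ j, a j ∈ derivedSeries G n → a j = 1 := by
  have hsep : ∀ g : G, ∃ n : ℕ, g ∈ derivedSeries G n → g = 1 := by
    intro g
    by_contra! h
    have hg : g ∈ ⨅ i : ℕ, derivedSeries G i := Subgroup.mem_iInf.2 fun i => (h i).1
    rw [hInt, Subgroup.mem_bot] at hg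
    exact (h 0).2 hg
  choose d hd using fun j => hsep (a j)
  exact ⟨Finset.univ.sup d, fun j hj =>
    hd j (derivedSeries_antitone G (Finset.le_sup (Finset.mem_univ j)) hj)⟩

/-- Let `G` be a group whose derived series has trivial intersection and
torsion-free (abelian) quotients `G⁽ⁱ⁾/G⁽ⁱ⁺¹⁾`. Let `a₁, …, a_k ∈ G`, and let
`H` be a subgroup of `G` whose derived series is strictly descending at every
step. Then there is an element `x ∈ H` that is not conjugate in `G` to any
power of any `a_j`. -/
theorem exists_elt_not_conj_to_powers {G : Type*} [Group G]
    (hInt : ⨅ i : ℕ, derivedSeries G i = ⊥)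
    (hTF : ∀ i : ℕ, ∀ x ∈ derivedSeries G i, ∀ n : ℕ, 0 < n →
      x ^ n ∈ derivedSeries G (i + 1) → x ∈ derivedSeries G (i + 1))
    (k : ℕ) (a : Fin k → G) (H : Subgroup G)
    (hH : ∀ i : ℕ, derivedSeries H (i + 1) < derivedSeries H i) :
    ∃ x ∈ H, ∀ (c : G) (j : Fin k) (ℓ : ℤ), x ≠ c⁻¹ * (a j) ^ ℓ * c := by
  obtain ⟨n, hn⟩ := exists_derivedSeries_eq_one_of_mem hInt a
  obtain ⟨y, hy, hy1⟩ := (derivedSeries H n).bot_or_exists_ne_one.resolve_left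
    (bot_le.trans_lt (hH n)).ne'
  have hyG : (y : G) ∈ derivedSeries G n :=
    map_derivedSeries_le_derivedSeries H.subtype n (Subgroup.mem_map_of_mem H.subtype hy)
  refine ⟨y, y.2, fun c j ℓ h => hy1 (Subtype.ext ?_)⟩
  have hpow : a j ^ ℓ ∈ derivedSeries G n := by
    have hconj : a j ^ ℓ = c * y * c⁻¹ := by rw [h]; group
    rw [hconj]
    exact (derivedSeries_normal G n).conj_mem _ hyG c
  rcases eq_or_ne ℓ 0 with rfl | hℓ
  · simpa using h
  · have hnat : a j ^ ℓ.natAbs ∈ derivedSeries G n := by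
      obtain ⟨m, rfl | rfl⟩ := ℓ.eq_nat_or_neg <;> simpa using hpow
    have ha := hn j (mem_derivedSeries_of_pow_mem hTF (Int.natAbs_pos.2 hℓ) n hnat)
    simpa [ha] using h
end
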